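/- arXiv:0904.1641 — 2 statements merged into one kernel-verified Lean document; each statement's English description precedes it below -/
import Mathlib

section
/- For every real number k and all real numbers a, b with 0 < a ≤ b < 1, one has ∫_a^b f(-q^5)^{5-6k} · f(-q)^{6k-1} · q^{-k} dq = -∫_{u(a)}^{u(b)} x^{k-1} / √(125 + 22x + x²) dx (equivalently, = ∫_{u(b)}^{u(a)} x^{k-1}/√(125+22x+x²) dx, since u is decreasing). -/
open MeasureTheory Real

/-- Euler's product `f(-q) = ∏_{n=1}^∞ (1 - qⁿ)`. -/
noncomputable def eulerF (q : ℝ) : ℝ := ∏' n : ℕ, (1 - q ^ (n + 1))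

/-- `u(q) = f(-q)⁶ / (q · f(-q⁵)⁶)`. -/
noncomputable def uF (q : ℝ) : ℝ := eulerF q ^ 6 / (q * eulerF (q ^ 5) ^ 6)

section
open ModularForm Function.Periodic UpperHalfPlane

/-- The complex Euler product `∏ (1 - qⁿ)`. -/
noncomputable def eulerC (q : ℂ) : ℂ := ∏' n : ℕ, (1 - q ^ (n + 1))

lemma one_sub_pow_ne_zero {q : ℂ} (hq : ‖q‖ < 1) (n : ℕ) : 1 - q ^ (n + 1) ≠ 0 := by
  intro h
  have h2 : ‖q‖ ^ (n + 1) = 1 := by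
    rw [← norm_pow, ← sub_eq_zero.mp h, norm_one]
  exact (pow_lt_one₀ (norm_nonneg _) hq n.succ_ne_zero).ne h2

lemma eulerC_ne_zero {q : ℂ} (hq : ‖q‖ < 1) : eulerC q ≠ 0 := by
  have := tprod_one_add_ne_zero_of_summable (f := fun n : ℕ ↦ -q ^ (n + 1))
    (fun n ↦ by simpa [sub_eq_add_neg] using one_sub_pow_ne_zero hq n)
    (by
      simpa using! (summable_nat_add_iff 1).mpr
        (summable_geometric_of_lt_one (norm_nonneg _) hq))
  simpa only [eulerC, sub_eq_add_neg] using this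

lemma eulerC_zero : eulerC 0 = 1 := by simp [eulerC]

lemma differentiableOn_eulerC : DifferentiableOn ℂ eulerC (Metric.ball 0 1) :=
  differentiableOn_tprod_one_sub_pow

lemma differentiableAt_eulerC {q : ℂ} (hq : ‖q‖ < 1) : DifferentiableAt ℂ eulerC q :=
  differentiableOn_eulerC.differentiableAt (Metric.isOpen_ball.mem_nhds (by simpa using hq))

lemma differentiableAt_deriv_eulerC {q : ℂ} (hq : ‖q‖ < 1) :
    DifferentiableAt ℂ (deriv eulerC) q :=
  (differentiableOn_eulerC.deriv Metric.isOpen_ball).differentiableAt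
    (Metric.isOpen_ball.mem_nhds (by simpa using hq))

lemma deriv_eulerC_zero : deriv eulerC 0 = -1 := by
  have h0 : (0 : ℂ) ∈ Metric.ball (0 : ℂ) 1 := by simp
  have hterm : ∀ n : ℕ, logDeriv (fun q : ℂ ↦ 1 - q ^ (n + 1)) 0 = if n = 0 then -1 else 0 := by
    intro n
    rcases n with _ | n <;> simp [logDeriv_apply]
  have h := logDeriv_tprod_eq_tsum (f := fun (n : ℕ) (q : ℂ) ↦ 1 - q ^ (n + 1))
    Metric.isOpen_ball h0 (by simp) (fun _ ↦ by fun_prop)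
    (by simp_rw [hterm]; exact (hasSum_ite_eq 0 (-1 : ℂ)).summable)
    multipliableLocallyUniformlyOn_one_sub_pow (by simp)
  simp_rw [hterm, tsum_ite_eq] at h
  change logDeriv eulerC 0 = -1 at h
  simpa [logDeriv_apply, eulerC_zero] using h

lemma ofReal_eulerF {q : ℝ} (hq : |q| < 1) : (eulerF q : ℂ) = eulerC q := by
  have hm : Multipliable fun n : ℕ ↦ 1 - q ^ (n + 1) := by
    simp_rw [sub_eq_add_neg]
    apply multipliable_one_add_of_summable
    simpa using (summable_nat_add_iff 1).mpr (summable_geometric_of_lt_one (abs_nonneg q) hq)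
  have := hm.map_tprod Complex.ofRealHom Complex.continuous_ofReal
  simpa [eulerF, eulerC] using this

/-- Minus the logarithmic derivative of `uC` for `q d/dq`, through those of the Euler product. -/
noncomputable def eisP (q : ℂ) : ℂ :=
  1 - 6 * q * (deriv eulerC q / eulerC q) +
    30 * q ^ 5 * (deriv eulerC (q ^ 5) / eulerC (q ^ 5))

/-- The complex version of `uF`. -/
noncomputable def uC (q : ℂ) : ℂ := eulerC q ^ 6 / (q * eulerC (q ^ 5) ^ 6)

/-- The defect in the weight four relation between `eisP` and Euler products. -/
noncomputable def defectC (q : ℂ) : ℂ :=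
  eisP q ^ 2 / (eulerC q ^ 4 * eulerC (q ^ 5) ^ 4) -
    (eulerC q ^ 6 / eulerC (q ^ 5) ^ 6 + 22 * q + 125 * q ^ 2 * eulerC (q ^ 5) ^ 6 / eulerC q ^ 6)

lemma norm_pow_five_lt_one {q : ℂ} (hq : ‖q‖ < 1) : ‖q ^ 5‖ < 1 := by
  rw [norm_pow]
  exact pow_lt_one₀ (norm_nonneg _) hq (by norm_num)

lemma hasDerivAt_eulerC_pow_five {q : ℂ} (hq : ‖q‖ < 1) :
    HasDerivAt (fun z ↦ eulerC (z ^ 5)) (deriv eulerC (q ^ 5) * (5 * q ^ 4)) q := by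
  have h := (differentiableAt_eulerC (norm_pow_five_lt_one hq)).hasDerivAt.comp q
    (hasDerivAt_pow 5 q)
  simpa using! h

lemma differentiableAt_eisP {q : ℂ} (hq : ‖q‖ < 1) : DifferentiableAt ℂ eisP q := by
  have h1 := differentiableAt_eulerC hq
  have h2 := (hasDerivAt_eulerC_pow_five hq).differentiableAt
  have h3 := differentiableAt_deriv_eulerC hq
  have h4 : DifferentiableAt ℂ (fun z ↦ deriv eulerC (z ^ 5)) q :=
    (differentiableAt_deriv_eulerC (norm_pow_five_lt_one hq)).comp q (differentiableAt_pow 5)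
  have h5 := eulerC_ne_zero hq
  have h6 := eulerC_ne_zero (norm_pow_five_lt_one hq)
  exact ((((differentiableAt_id).const_mul 6).mul (h3.div h1 h5)).const_sub 1).add
    ((((differentiableAt_pow 5)).const_mul 30).mul (h4.div h2 h6))

lemma hasDerivAt_uC {q : ℂ} (hq : ‖q‖ < 1) (h0 : q ≠ 0) :
    HasDerivAt uC (-(uC q * eisP q / q)) q := by
  have h1 := (differentiableAt_eulerC hq).hasDerivAt
  have h2 := hasDerivAt_eulerC_pow_five hq
  have h5 := eulerC_ne_zero hq
  have h6 := eulerC_ne_zero (norm_pow_five_lt_one hq)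
  have h := (h1.pow 6).div ((hasDerivAt_id q).mul (h2.pow 6))
    (mul_ne_zero h0 (pow_ne_zero 6 h6))
  refine h.congr_deriv ?_
  simp only [Pi.pow_apply, Pi.mul_apply, id, uC, eisP]
  field_simp
  push_cast
  ring

lemma differentiableAt_defectC {q : ℂ} (hq : ‖q‖ < 1) : DifferentiableAt ℂ defectC q := by
  have h1 := differentiableAt_eulerC hq
  have h2 := (hasDerivAt_eulerC_pow_five hq).differentiableAt
  have h3 := differentiableAt_eisP hq
  have h5 := eulerC_ne_zero hq
  have h6 := eulerC_ne_zero (norm_pow_five_lt_one hq)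
  unfold defectC
  fun_prop (disch := positivity)

lemma defectC_zero : defectC 0 = 0 := by
  simp [defectC, eisP, eulerC_zero]

lemma deriv_defectC_zero : deriv defectC 0 = 0 := by
  have hq : ‖(0 : ℂ)‖ < 1 := by simp
  have hq5 : ‖(0 : ℂ) ^ 5‖ < 1 := by simp
  have h1 := (differentiableAt_eulerC hq).hasDerivAt
  have h2 := hasDerivAt_eulerC_pow_five hq
  have h3 : HasDerivAt (fun z ↦ deriv eulerC z / eulerC z) _ 0 :=
    ((differentiableAt_deriv_eulerC hq).div (differentiableAt_eulerC hq)
      (eulerC_ne_zero hq)).hasDerivAt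
  have h4 : HasDerivAt (fun z ↦ deriv eulerC (z ^ 5) / eulerC (z ^ 5)) _ 0 :=
    (((differentiableAt_deriv_eulerC hq5).comp (0 : ℂ) (differentiableAt_pow 5)).div h2.differentiableAt
      (eulerC_ne_zero hq5)).hasDerivAt
  have hP : HasDerivAt eisP 6 0 := by
    have h := ((((hasDerivAt_id (0 : ℂ)).const_mul 6).mul h3).const_sub 1).add
      (((hasDerivAt_pow 5 (0 : ℂ)).const_mul 30).mul h4)
    refine h.congr_deriv ?_
    simp [eulerC_zero, deriv_eulerC_zero]
  have h := ((hP.pow 2).div ((h1.pow 4).mul (h2.pow 4))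
    (by simp [eulerC_zero])).sub ((((h1.pow 6).div (h2.pow 6) (by simp [eulerC_zero])).add
    ((hasDerivAt_id (0 : ℂ)).const_mul 22)).add
    ((((hasDerivAt_pow 2 (0 : ℂ)).const_mul 125).mul (h2.pow 6)).div (h1.pow 6)
      (by simp [eulerC_zero])))
  refine (HasDerivAt.deriv (f := defectC) h).trans ?_
  simp [eulerC_zero, deriv_eulerC_zero, eisP]
  norm_num

lemma eta_eq_qParam_mul_eulerC (z : ℂ) : η z = qParam 24 z * eulerC (qParam 1 z) := rfl

lemma qParam_five_mul (z : ℂ) : qParam 1 (5 * z) = qParam 1 z ^ 5 := by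
  simp only [qParam, ← Complex.exp_nat_mul]
  congr 1
  push_cast
  ring

lemma norm_qParam_one_lt_one {z : ℂ} (hz : 0 < z.im) : ‖qParam 1 z‖ < 1 := by
  rw [norm_qParam, Real.exp_lt_one_iff]
  have := mul_pos Real.pi_pos hz
  simp only [div_one]
  linarith

lemma qParam_one_add_intCast (z : ℂ) (n : ℤ) : qParam 1 (z + n) = qParam 1 z := by
  simp only [qParam, Complex.ofReal_one, div_one, mul_add, Complex.exp_add]
  rw [mul_comm _ (n : ℂ), Complex.exp_int_mul_two_pi_mul_I, mul_one]

/-- The twelfth root of unity by which `η²` is multiplied under `z ↦ z + 1`. -/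
noncomputable def etaRoot : ℂ := Complex.exp (π * Complex.I / 6)

lemma etaRoot_pow_twelve : etaRoot ^ 12 = 1 := by
  rw [etaRoot, ← Complex.exp_nat_mul, ← Complex.exp_two_pi_mul_I]
  congr 1
  push_cast
  ring

lemma eta_add_one_sq (z : ℂ) : η (z + 1) ^ 2 = etaRoot * η z ^ 2 := by
  have h1 : qParam 1 (z + 1) = qParam 1 z := by simpa using qParam_one_add_intCast z 1
  have h24 : qParam 24 (z + 1) ^ 2 = etaRoot * qParam 24 z ^ 2 := by
    simp only [qParam, etaRoot, ← Complex.exp_nat_mul, ← Complex.exp_add]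
    congr 1
    push_cast
    ring
  simp only [eta_eq_qParam_mul_eulerC, h1, mul_pow, h24]
  ring

lemma eta_add_two_sq (z : ℂ) : η (z + 2) ^ 2 = etaRoot ^ 2 * η z ^ 2 := by
  rw [show z + 2 = z + 1 + 1 by ring, eta_add_one_sq (z + 1), eta_add_one_sq]
  ring

lemma csqrt_sq (z : ℂ) : Complex.sqrt z ^ 2 = z := by
  rw [Complex.sqrt]
  exact_mod_cast Complex.cpow_nat_inv_pow z two_ne_zero

lemma eta_neg_inv_sq {z : ℂ} (hz : 0 < z.im) : η (-1 / z) ^ 2 = -Complex.I * z * η z ^ 2 := by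
  have h : η (-1 / z) = _ := eta_comp_eq_csqrt_I_inv (show z ∈ upperHalfPlaneSet from hz)
  rw [h]
  simp only [Pi.smul_apply, Pi.mul_apply, smul_eq_mul, mul_pow, inv_pow, csqrt_sq, Complex.inv_I]
  ring

lemma im_neg_inv_pos {z : ℂ} (hz : 0 < z.im) : 0 < (-1 / z).im := by
  have h : z ≠ 0 := by rintro rfl; simp at hz
  rw [neg_div, one_div, Complex.neg_im, Complex.inv_im, neg_div, neg_neg]
  exact div_pos hz (Complex.normSq_pos.mpr h)

lemma eta_div_two_mul_add_one_sq {s : ℂ} (hs : 0 < s.im) :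
    etaRoot ^ 2 * η (s / (2 * s + 1)) ^ 2 = (2 * s + 1) * η s ^ 2 := by
  have hs0 : s ≠ 0 := by rintro rfl; simp at hs
  have hs1 : 2 * s + 1 ≠ 0 := by
    intro h
    have := congrArg Complex.im h
    simp at this
    exact hs.ne' this
  have hw : 0 < (-1 / s - 2).im := by simpa using im_neg_inv_pos hs
  have hw0 : -1 / s - 2 = -(2 * s + 1) / s := by field_simp; ring
  have e : s / (2 * s + 1) = -1 / (-1 / s - 2) := by
    rw [hw0]
    field_simp
  have h2 : η (-1 / s) ^ 2 = etaRoot ^ 2 * η (-1 / s - 2) ^ 2 := by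
    rw [← eta_add_two_sq, sub_add_cancel]
  rw [e, eta_neg_inv_sq hw]
  calc _ = -Complex.I * (-1 / s - 2) * (etaRoot ^ 2 * η (-1 / s - 2) ^ 2) := by ring
    _ = Complex.I ^ 2 * ((-1 / s - 2) * s) * η s ^ 2 := by
      rw [← h2, eta_neg_inv_sq hs]; ring
    _ = _ := by
      rw [hw0, Complex.I_sq]
      field_simp

/-- The Hauptmodul `(η(z) / η(5z))⁶` of `Γ₀(5)`. -/
noncomputable def hauptU (z : ℂ) : ℂ := η z ^ 6 / η (5 * z) ^ 6

/-- The weight four form `η(z)⁴ η(5z)⁴` on `Γ₀(5)`. -/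
noncomputable def cuspC (z : ℂ) : ℂ := η z ^ 4 * η (5 * z) ^ 4

lemma five_mul_im_pos {z : ℂ} (hz : 0 < z.im) : 0 < (5 * z).im := by
  simpa using hz

lemma hauptU_ne_zero {z : ℂ} (hz : 0 < z.im) : hauptU z ≠ 0 :=
  div_ne_zero (pow_ne_zero _ (eta_ne_zero hz)) (pow_ne_zero _ (eta_ne_zero (five_mul_im_pos hz)))

lemma cuspC_ne_zero {z : ℂ} (hz : 0 < z.im) : cuspC z ≠ 0 :=
  mul_ne_zero (pow_ne_zero _ (eta_ne_zero hz)) (pow_ne_zero _ (eta_ne_zero (five_mul_im_pos hz)))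

lemma hauptU_eq_uC (z : ℂ) : hauptU z = uC (qParam 1 z) := by
  have h : qParam 24 (5 * z) ^ 6 = qParam 1 z * qParam 24 z ^ 6 := by
    simp only [qParam, ← Complex.exp_nat_mul, ← Complex.exp_add]
    congr 1
    push_cast
    ring
  have h0 := pow_ne_zero 6 (qParam_ne_zero (h := 24) z)
  simp only [hauptU, uC, eta_eq_qParam_mul_eulerC, qParam_five_mul, mul_pow, h]
  rw [mul_comm (qParam 1 z), mul_assoc, mul_div_mul_left _ _ h0]

lemma cuspC_eq (z : ℂ) :
    cuspC z = qParam 1 z * (eulerC (qParam 1 z) ^ 4 * eulerC (qParam 1 z ^ 5) ^ 4) := by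
  have h : qParam 24 z ^ 4 * qParam 24 (5 * z) ^ 4 = qParam 1 z := by
    simp only [qParam, ← Complex.exp_nat_mul, ← Complex.exp_add]
    congr 1
    push_cast
    ring
  simp only [cuspC, eta_eq_qParam_mul_eulerC, qParam_five_mul, mul_pow]
  rw [← h]
  ring

/-- The Fricke involution `z ↦ -1 / (5z)`. -/
noncomputable def fricke (z : ℂ) : ℂ := -1 / (5 * z)

/-- The Atkin-Lehner involution of level five centred at `1 / 2`. -/
noncomputable def halfInvolution (z : ℂ) : ℂ := (5 * z - 3) / (10 * z - 5)

lemma fricke_im_pos {z : ℂ} (hz : 0 < z.im) : 0 < (fricke z).im :=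
  im_neg_inv_pos (five_mul_im_pos hz)

lemma ne_zero_of_im_pos {z : ℂ} (hz : 0 < z.im) : z ≠ 0 := by
  rintro rfl; simp at hz

lemma two_mul_sub_one_im_pos {z : ℂ} (hz : 0 < z.im) : 0 < (2 * z - 1).im := by
  simpa using hz

lemma two_mul_sub_one_ne_zero {z : ℂ} (hz : 0 < z.im) : 2 * z - 1 ≠ 0 :=
  ne_zero_of_im_pos (two_mul_sub_one_im_pos hz)

lemma halfInvolution_eq {z : ℂ} (hz : 0 < z.im) :
    halfInvolution z = 1 / 2 + 1 / 10 * (-1 / (2 * z - 1)) := by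
  have h := two_mul_sub_one_ne_zero hz
  rw [halfInvolution, show 10 * z - 5 = 5 * (2 * z - 1) by ring, ← div_div]
  linear_combination 1 / 2 * mul_inv_cancel₀ h

lemma halfInvolution_im_pos {z : ℂ} (hz : 0 < z.im) : 0 < (halfInvolution z).im := by
  rw [halfInvolution_eq hz]
  have := im_neg_inv_pos (two_mul_sub_one_im_pos hz)
  have e : (1 / 2 + 1 / 10 * (-1 / (2 * z - 1))).im = 1 / 10 * (-1 / (2 * z - 1)).im := by
    rw [Complex.add_im, show (1 / 10 : ℂ) = ((1 / 10 : ℝ) : ℂ) by push_cast; rfl,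
      Complex.im_ofReal_mul]
    simp
  rw [e]
  positivity

lemma hauptU_fricke {z : ℂ} (hz : 0 < z.im) : hauptU (fricke z) * hauptU z = 125 := by
  have h1 := eta_neg_inv_sq (five_mul_im_pos hz)
  have h2 := eta_neg_inv_sq hz
  have z0 := ne_zero_of_im_pos hz
  have e : 5 * fricke z = -1 / z := by rw [fricke]; field_simp
  have e1 := eta_ne_zero (show z ∈ upperHalfPlaneSet from hz)
  have e5 := eta_ne_zero (show 5 * z ∈ upperHalfPlaneSet from five_mul_im_pos hz)
  have i0 := Complex.I_ne_zero
  rw [hauptU, hauptU, e, fricke, show η (-1 / (5 * z)) ^ 6 = (η (-1 / (5 * z)) ^ 2) ^ 3 by ring,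
    show η (-1 / z) ^ 6 = (η (-1 / z) ^ 2) ^ 3 by ring, h1, h2]
  field_simp
  norm_num

lemma cuspC_fricke {z : ℂ} (hz : 0 < z.im) : cuspC (fricke z) = 25 * z ^ 4 * cuspC z := by
  have h1 := eta_neg_inv_sq (five_mul_im_pos hz)
  have h2 := eta_neg_inv_sq hz
  have z0 := ne_zero_of_im_pos hz
  have e : 5 * fricke z = -1 / z := by rw [fricke]; field_simp
  rw [cuspC, cuspC, e, fricke, show η (-1 / (5 * z)) ^ 4 = (η (-1 / (5 * z)) ^ 2) ^ 2 by ring,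
    show η (-1 / z) ^ 4 = (η (-1 / z) ^ 2) ^ 2 by ring, h1, h2]
  linear_combination (25 * z ^ 4 * η z ^ 4 * η (5 * z) ^ 4) * Complex.I_pow_four

lemma eta_halfInvolution_sq {z : ℂ} (hz : 0 < z.im) :
    etaRoot ^ 5 * η (halfInvolution z) ^ 2 = 5 * (2 * z - 1) * η (5 * z) ^ 2 := by
  have hs : 0 < (5 * z - 3).im := by simpa using hz
  have h := eta_div_two_mul_add_one_sq hs
  have e : (5 * z - 3) / (2 * (5 * z - 3) + 1) = halfInvolution z := by
    rw [halfInvolution]; congr 1; ring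
  have h1 : η (5 * z) ^ 2 = etaRoot ^ 3 * η (5 * z - 3) ^ 2 := by
    rw [show 5 * z = 5 * z - 3 + 2 + 1 by ring, eta_add_one_sq, eta_add_two_sq,
      show 5 * z - 3 + 2 + 1 - 3 = 5 * z - 3 by ring]
    ring
  rw [e] at h
  rw [h1]
  linear_combination etaRoot ^ 3 * h

lemma eta_five_mul_halfInvolution_sq {z : ℂ} (hz : 0 < z.im) :
    etaRoot * η (5 * halfInvolution z) ^ 2 = (2 * z - 1) * η z ^ 2 := by
  have ht : 0 < (z - 1).im := by simpa using hz
  have h := eta_div_two_mul_add_one_sq ht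
  have h1 := eta_add_one_sq (z - 1)
  have h2 := eta_add_two_sq ((z - 1) / (2 * (z - 1) + 1))
  have h0 := two_mul_sub_one_ne_zero hz
  have e : (z - 1) / (2 * (z - 1) + 1) + 2 = 5 * halfInvolution z := by
    rw [halfInvolution, show 10 * z - 5 = 5 * (2 * z - 1) by ring, show 2 * (z - 1) + 1 = 2 * z - 1 by ring,
      ← div_div]
    linear_combination -2 * mul_inv_cancel₀ h0
  rw [e] at h2
  rw [show z - 1 + 1 = z by ring] at h1
  rw [h1, h2]
  linear_combination etaRoot * h

lemma hauptU_halfInvolution {z : ℂ} (hz : 0 < z.im) :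
    hauptU (halfInvolution z) * hauptU z = 125 := by
  have h1 := eta_halfInvolution_sq hz
  have h2 := eta_five_mul_halfInvolution_sq hz
  have h0 := two_mul_sub_one_ne_zero hz
  have e1 := eta_ne_zero (show z ∈ upperHalfPlaneSet from hz)
  have e5 := eta_ne_zero (show 5 * z ∈ upperHalfPlaneSet from five_mul_im_pos hz)
  have e6 := eta_ne_zero (show 5 * halfInvolution z ∈ upperHalfPlaneSet from
    five_mul_im_pos (halfInvolution_im_pos hz))
  have h3 : η (halfInvolution z) ^ 6 * η z ^ 6 * (2 * z - 1) ^ 3 =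
      125 * (η (5 * halfInvolution z) ^ 6 * η (5 * z) ^ 6) * (2 * z - 1) ^ 3 := by
    calc _ = η (halfInvolution z) ^ 6 * ((2 * z - 1) * η z ^ 2) ^ 3 := by ring
      _ = etaRoot ^ 3 * η (halfInvolution z) ^ 6 * η (5 * halfInvolution z) ^ 6 := by
        rw [← h2]; ring
      _ = etaRoot ^ 12 * (etaRoot ^ 3 * η (halfInvolution z) ^ 6) *
          η (5 * halfInvolution z) ^ 6 := by rw [etaRoot_pow_twelve, one_mul]
      _ = (etaRoot ^ 5 * η (halfInvolution z) ^ 2) ^ 3 * η (5 * halfInvolution z) ^ 6 := by ring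
      _ = _ := by rw [h1]; ring
  have h4 := mul_right_cancel₀ (pow_ne_zero 3 h0) h3
  rw [hauptU, hauptU, div_mul_div_comm, h4]
  field_simp

lemma cuspC_halfInvolution {z : ℂ} (hz : 0 < z.im) :
    cuspC (halfInvolution z) = 25 * (2 * z - 1) ^ 4 * cuspC z := by
  have h1 := eta_halfInvolution_sq hz
  have h2 := eta_five_mul_halfInvolution_sq hz
  calc _ = etaRoot ^ 12 * cuspC (halfInvolution z) := by rw [etaRoot_pow_twelve, one_mul]
    _ = (etaRoot ^ 5 * η (halfInvolution z) ^ 2) ^ 2 *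
        (etaRoot * η (5 * halfInvolution z) ^ 2) ^ 2 := by rw [cuspC]; ring
    _ = _ := by rw [h1, h2, cuspC]; ring

lemma hasDerivAt_qParam_one (z : ℂ) :
    HasDerivAt (qParam 1) (2 * π * Complex.I * qParam 1 z) z := by
  have h := ((hasDerivAt_id z).const_mul (2 * π * Complex.I)).cexp
  have e : qParam 1 = fun z ↦ Complex.exp (2 * π * Complex.I * id z) := by
    ext w; simp [qParam]
  rw [e]
  exact h.congr_deriv (by simp [mul_comm])

lemma hasDerivAt_hauptU {z : ℂ} (hz : 0 < z.im) :
    HasDerivAt hauptU (-(2 * π * Complex.I) * (hauptU z * eisP (qParam 1 z))) z := by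
  have e : hauptU = uC ∘ qParam 1 := funext hauptU_eq_uC
  have hq := qParam_ne_zero (h := 1) z
  have h := (hasDerivAt_uC (norm_qParam_one_lt_one hz) hq).comp z (hasDerivAt_qParam_one z)
  rw [← e] at h
  refine h.congr_deriv ?_
  rw [← hauptU_eq_uC]
  field_simp

/-- The `Γ₀(5)`-invariant function on the upper half plane that vanishes identically exactly when
`defectC` does. -/
noncomputable def defectH (z : ℂ) : ℂ := defectC (qParam 1 z) / qParam 1 z

lemma defectH_eq {z : ℂ} (hz : 0 < z.im) :
    defectH z = eisP (qParam 1 z) ^ 2 / cuspC z - (hauptU z + 22 + 125 / hauptU z) := by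
  have h5 := eulerC_ne_zero (norm_qParam_one_lt_one hz)
  have h6 := eulerC_ne_zero (norm_pow_five_lt_one (norm_qParam_one_lt_one hz))
  have hq := qParam_ne_zero (h := 1) z
  rw [defectH, defectC, cuspC_eq, hauptU_eq_uC, uC]
  field_simp

lemma defectH_comp_eq {φ : ℂ → ℂ} {φ' z : ℂ} (hz : 0 < z.im) (hφz : 0 < (φ z).im)
    (hφ : HasDerivAt φ φ' z) (hU : ∀ w : ℂ, 0 < w.im → hauptU (φ w) * hauptU w = 125)
    (hC : φ' ^ 2 * cuspC (φ z) = cuspC z) : defectH (φ z) = defectH z := by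
  have hd := ((hasDerivAt_hauptU hφz).comp z hφ).mul (hasDerivAt_hauptU hz)
  have hev : ((hauptU ∘ φ) * hauptU) =ᶠ[nhds z] fun _ ↦ 125 := by
    filter_upwards [isOpen_upperHalfPlaneSet.mem_nhds hz] with w hw using hU w hw
  have h0 := hd.unique ((hasDerivAt_const z (125 : ℂ)).congr_of_eventuallyEq hev)
  have u0 := hauptU_ne_zero hz
  have u1 := hauptU_ne_zero hφz
  have hP : eisP (qParam 1 (φ z)) * φ' = -eisP (qParam 1 z) := by
    have hc : -(2 * π * Complex.I) * (hauptU (φ z) * hauptU z) ≠ 0 := by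
      simp [Real.pi_ne_zero, u0, u1]
    apply mul_left_cancel₀ hc
    simp only [Function.comp_apply] at h0
    linear_combination h0
  have c0 := cuspC_ne_zero hz
  have c1 := cuspC_ne_zero hφz
  have hU1 : hauptU z = 125 / hauptU (φ z) := by
    rw [eq_div_iff u1, ← hU z hz, mul_comm]
  have hU2 : hauptU (φ z) = 125 / hauptU z := by
    rw [eq_div_iff u0, hU z hz]
  have hPC : eisP (qParam 1 (φ z)) ^ 2 / cuspC (φ z) = eisP (qParam 1 z) ^ 2 / cuspC z := by
    rw [div_eq_div_iff c1 c0, ← hC]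
    linear_combination cuspC (φ z) * (eisP (qParam 1 (φ z)) * φ' - eisP (qParam 1 z)) * hP
  rw [defectH_eq hz, defectH_eq hφz, hPC, ← hU1, ← hU2]
  ring

lemma defectH_fricke {z : ℂ} (hz : 0 < z.im) : defectH (fricke z) = defectH z := by
  have z0 := ne_zero_of_im_pos hz
  have hd : HasDerivAt fricke (1 / (5 * z ^ 2)) z := by
    have h := (hasDerivAt_const z (-1 : ℂ)).div ((hasDerivAt_id z).const_mul 5)
      (mul_ne_zero (by norm_num) z0)
    refine h.congr_deriv ?_
    simp only [id]
    field_simp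
    norm_num
  refine defectH_comp_eq hz (fricke_im_pos hz) hd (fun w hw ↦ hauptU_fricke hw) ?_
  rw [cuspC_fricke hz]
  field_simp
  norm_num

lemma defectH_halfInvolution {z : ℂ} (hz : 0 < z.im) :
    defectH (halfInvolution z) = defectH z := by
  have z0 := two_mul_sub_one_ne_zero hz
  have e : 10 * z - 5 = 5 * (2 * z - 1) := by ring
  have hd : HasDerivAt halfInvolution (1 / (5 * (2 * z - 1) ^ 2)) z := by
    have h := (((hasDerivAt_id z).const_mul 5).sub_const 3).div
      (((hasDerivAt_id z).const_mul 10).sub_const 5) (by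
        rw [id, e]; exact mul_ne_zero (by norm_num) z0)
    refine h.congr_deriv ?_
    rw [id, e, div_eq_div_iff (by simp [z0]) (by simp [z0])]
    ring
  refine defectH_comp_eq hz (halfInvolution_im_pos hz) hd (fun w hw ↦ hauptU_halfInvolution hw) ?_
  rw [cuspC_halfInvolution hz, div_pow, one_pow]
  have : (5 * (2 * z - 1) ^ 2) ^ 2 ≠ 0 := by simp [z0]
  rw [one_div_mul_eq_div, div_eq_iff this]
  ring

lemma defectH_add_intCast (z : ℂ) (n : ℤ) : defectH (z + n) = defectH z := by
  rw [defectH, defectH, qParam_one_add_intCast]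

lemma exists_defectH_eq_mul_im_le {z : ℂ} (hz : 0 < z.im) (hz' : z.im ≤ 1 / 10) :
    ∃ w : ℂ, 20 / 17 * z.im ≤ w.im ∧ defectH w = defectH z := by
  set w : ℂ := z + (-⌊z.re + 2 / 5⌋ : ℤ) with hw
  have him : w.im = z.im := by simp [hw]
  have hre : w.re = z.re - ⌊z.re + 2 / 5⌋ := by simp [hw, sub_eq_add_neg]
  have h1 : -(2 / 5) ≤ w.re := by
    have := Int.floor_le (z.re + 2 / 5)
    linarith
  have h2 : w.re ≤ 3 / 5 := by
    have := Int.lt_floor_add_one (z.re + 2 / 5)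
    linarith
  have hD : defectH w = defectH z := defectH_add_intCast _ _
  have hw0 : 0 < w.im := him ▸ hz
  rw [← him, ← hD]
  rw [← him] at hz'
  clear_value w
  rcases le_total w.re (2 / 5) with h | h
  · refine ⟨fricke w, ?_, defectH_fricke hw0⟩
    have e : (fricke w).im = w.im / (5 * (w.re ^ 2 + w.im ^ 2)) := by
      rw [fricke, neg_div, one_div, Complex.neg_im, Complex.inv_im, Complex.normSq_apply]
      simp
      field_simp
    have hp : 0 < 5 * (w.re ^ 2 + w.im ^ 2) := by positivity
    rw [e, le_div_iff₀ hp]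
    have : 20 / 17 * (5 * (w.re ^ 2 + w.im ^ 2)) ≤ 1 := by nlinarith
    nlinarith
  · refine ⟨halfInvolution w, ?_, defectH_halfInvolution hw0⟩
    have e : (halfInvolution w).im = w.im / (5 * ((2 * w.re - 1) ^ 2 + (2 * w.im) ^ 2)) := by
      rw [halfInvolution_eq hw0, Complex.add_im,
        show (1 / 10 : ℂ) = ((1 / 10 : ℝ) : ℂ) by push_cast; rfl,
        Complex.im_ofReal_mul, neg_div, one_div (2 * w - 1), Complex.neg_im, Complex.inv_im,
        Complex.normSq_apply]
      simp
      field_simp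
      norm_num
    have hp : 0 < 5 * ((2 * w.re - 1) ^ 2 + (2 * w.im) ^ 2) := by positivity
    rw [e, le_div_iff₀ hp]
    have : 20 / 17 * (5 * ((2 * w.re - 1) ^ 2 + (2 * w.im) ^ 2)) ≤ 1 := by nlinarith
    nlinarith

lemma exists_defectH_eq_of_le_im {z : ℂ} (hz : 0 < z.im) :
    ∃ w : ℂ, 1 / 10 ≤ w.im ∧ defectH w = defectH z := by
  have key : ∀ (n : ℕ) (z : ℂ), 0 < z.im → 1 / 10 ≤ (20 / 17) ^ n * z.im →
      ∃ w : ℂ, 1 / 10 ≤ w.im ∧ defectH w = defectH z := by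
    intro n
    induction n with
    | zero => exact fun z _ h ↦ ⟨z, by simpa using h, rfl⟩
    | succ n ih =>
      intro z hz h
      rcases le_total z.im (1 / 10) with h1 | h1
      · obtain ⟨w, hw, hD⟩ := exists_defectH_eq_mul_im_le hz h1
        obtain ⟨v, hv, hD'⟩ := ih w (lt_of_lt_of_le (by positivity) hw) (h.trans (by
          rw [pow_succ, mul_assoc]
          gcongr))
        exact ⟨v, hv, hD'.trans hD⟩
      · exact ⟨z, h1, rfl⟩
  obtain ⟨n, hn⟩ := pow_unbounded_of_one_lt (1 / 10 / z.im) (by norm_num : (1 : ℝ) < 20 / 17)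
  exact key n z hz ((div_lt_iff₀ hz).mp hn).le

lemma defectC_eq_zero {q : ℂ} (hq : ‖q‖ < 1) : defectC q = 0 := by
  set H := dslope defectC 0 with hH
  have hH0 : H 0 = 0 := by rw [hH, dslope_same, deriv_defectC_zero]
  have hHq : ∀ q ≠ 0, H q = defectC q / q := by
    intro q h0
    rw [hH, dslope_of_ne _ h0, slope_def_field, defectC_zero, sub_zero, sub_zero]
  have hdiff : DifferentiableOn ℂ H (Metric.ball 0 1) :=
    (Complex.differentiableOn_dslope (Metric.ball_mem_nhds 0 one_pos)).mpr fun z hz ↦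
      (differentiableAt_defectC (by simpa using hz)).differentiableWithinAt
  set r := Real.exp (-(π / 5)) with hr
  have hr1 : r < 1 := by
    rw [hr, Real.exp_lt_one_iff]
    have := Real.pi_pos
    linarith
  have hsub : Metric.closedBall (0 : ℂ) r ⊆ Metric.ball 0 1 :=
    Metric.closedBall_subset_ball hr1
  obtain ⟨c, hc, hmax⟩ := (isCompact_closedBall (0 : ℂ) r).exists_isMaxOn
    ⟨0, by simp [hr, Real.exp_nonneg]⟩ (hdiff.mono hsub).continuousOn.norm
  have hmax' : IsMaxOn (norm ∘ H) (Metric.ball 0 1) c := by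
    intro p hp
    by_cases hp0 : p = 0
    · simp [hp0, hH0]
    have hz := im_invQParam_pos_of_norm_lt_one one_pos (by simpa using hp) hp0
    obtain ⟨w, hw, hD⟩ := exists_defectH_eq_of_le_im hz
    rw [defectH, defectH, qParam_right_inv one_ne_zero hp0, ← hHq _ hp0,
      ← hHq _ (qParam_ne_zero w)] at hD
    have hmem : qParam 1 w ∈ Metric.closedBall (0 : ℂ) r := by
      rw [mem_closedBall_zero_iff, norm_qParam, hr, Real.exp_le_exp]
      have := Real.pi_pos
      rw [div_one]
      nlinarith
    have := hmax hmem
    simpa [hD] using this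
  have hconst := Complex.eqOn_of_isPreconnected_of_isMaxOn_norm
    (convex_ball (0 : ℂ) 1).isPreconnected Metric.isOpen_ball hdiff (hsub hc) hmax'
  have hz : H q = 0 := by
    rw [hconst (show q ∈ _ by simpa using hq), ← hH0, hconst (show 0 ∈ _ by simp)]
    rfl
  by_cases h0 : q = 0
  · rw [h0, defectC_zero]
  · rw [hHq q h0, div_eq_zero_iff] at hz
    exact hz.resolve_right h0

lemma pos_of_continuousOn_of_ne_zero {g : ℝ → ℝ} (hg : ContinuousOn g (Set.Ico 0 1))
    (h0 : 0 < g 0) (hne : ∀ x ∈ Set.Ico (0 : ℝ) 1, g x ≠ 0) {x : ℝ}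
    (hx : x ∈ Set.Ico (0 : ℝ) 1) : 0 < g x := by
  by_contra! h
  obtain ⟨y, hy, hy0⟩ := intermediate_value_Icc' hx.1
    (hg.mono fun t ht ↦ ⟨ht.1, ht.2.trans_lt hx.2⟩) ⟨h, h0.le⟩
  exact hne y ⟨hy.1, hy.2.trans_lt hx.2⟩ hy0

lemma norm_ofReal_lt_one {x : ℝ} (hx : x ∈ Set.Ico (0 : ℝ) 1) : ‖(x : ℂ)‖ < 1 := by
  rw [Complex.norm_real, Real.norm_of_nonneg hx.1]
  exact hx.2

lemma pow_five_mem_Ico {x : ℝ} (hx : x ∈ Set.Ico (0 : ℝ) 1) : x ^ 5 ∈ Set.Ico (0 : ℝ) 1 :=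
  ⟨pow_nonneg hx.1 5, pow_lt_one₀ hx.1 hx.2 (by norm_num)⟩

lemma ofReal_eulerF_of_mem {x : ℝ} (hx : x ∈ Set.Ico (0 : ℝ) 1) :
    (eulerF x : ℂ) = eulerC x :=
  ofReal_eulerF (by rw [abs_of_nonneg hx.1]; exact hx.2)

lemma continuousOn_re_comp_ofReal {f : ℂ → ℂ}
    (hf : ∀ q : ℂ, ‖q‖ < 1 → DifferentiableAt ℂ f q) :
    ContinuousOn (fun x : ℝ ↦ (f x).re) (Set.Ico 0 1) := fun _ hx ↦
  ((hf _ (norm_ofReal_lt_one hx)).hasDerivAt.real_of_complex).continuousAt.continuousWithinAt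

lemma eulerF_pos {x : ℝ} (hx : x ∈ Set.Ico (0 : ℝ) 1) : 0 < eulerF x := by
  have h : ∀ x ∈ Set.Ico (0 : ℝ) 1, eulerF x = (eulerC x).re := fun x hx ↦ by
    rw [← ofReal_eulerF_of_mem hx, Complex.ofReal_re]
  refine pos_of_continuousOn_of_ne_zero
    ((continuousOn_re_comp_ofReal fun q hq ↦ differentiableAt_eulerC hq).congr h) ?_ ?_ hx
  · rw [h 0 (by simp)]
    simp [eulerC_zero]
  · intro y hy h0
    apply eulerC_ne_zero (norm_ofReal_lt_one hy)
    rw [← ofReal_eulerF_of_mem hy, h0, Complex.ofReal_zero]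

lemma Ioo_mem_Ico {x : ℝ} (hx : x ∈ Set.Ioo (0 : ℝ) 1) : x ∈ Set.Ico (0 : ℝ) 1 :=
  ⟨hx.1.le, hx.2⟩

lemma uF_pos {x : ℝ} (hx : x ∈ Set.Ioo (0 : ℝ) 1) : 0 < uF x := by
  have h1 := eulerF_pos (Ioo_mem_Ico hx)
  have h5 := eulerF_pos (pow_five_mem_Ico (Ioo_mem_Ico hx))
  have := hx.1
  unfold uF
  positivity

lemma ofReal_uF {x : ℝ} (hx : x ∈ Set.Ioo (0 : ℝ) 1) : (uF x : ℂ) = uC x := by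
  have hx' := Ioo_mem_Ico hx
  have h5 := ofReal_eulerF_of_mem (pow_five_mem_Ico hx')
  push_cast at h5
  rw [uF, uC, ← ofReal_eulerF_of_mem hx', ← h5]
  push_cast
  rfl

lemma hasDerivAt_uF_and_ofReal_eisP {x : ℝ} (hx : x ∈ Set.Ioo (0 : ℝ) 1) :
    HasDerivAt uF (-(uF x * (eisP x).re / x)) x ∧ eisP x = (eisP x).re := by
  have hx0 : (x : ℂ) ≠ 0 := by simpa using hx.1.ne'
  have hev : ∀ᶠ y in nhds x, (uF y : ℂ) = uC y := by
    filter_upwards [isOpen_Ioo.mem_nhds hx] with y hy using ofReal_uF hy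
  have hd := hasDerivAt_uC (norm_ofReal_lt_one (Ioo_mem_Ico hx)) hx0
  have hr : HasDerivAt uF _ x := hd.real_of_complex.congr_of_eventuallyEq
    (hev.mono fun y hy ↦ by
      simp only [← hy, Complex.ofReal_re])
  have hu := (hr.ofReal_comp).unique (hd.comp_ofReal.congr_of_eventuallyEq hev)
  have hu0 : uC x ≠ 0 := by
    rw [← ofReal_uF hx]
    exact_mod_cast (uF_pos hx).ne'
  have hP : eisP x =
      ((-(-(uC x * eisP x / x)).re * x / uF x : ℝ) : ℂ) := by
    push_cast
    rw [hu, ofReal_uF hx]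
    field_simp
  have hP' : eisP x = (eisP x).re := by
    conv_rhs => rw [hP]
    rw [Complex.ofReal_re, ← hP]
  refine ⟨hr.congr_deriv ?_, hP'⟩
  rw [hP', ← ofReal_uF hx]
  norm_cast

lemma eisP_re_sq {x : ℝ} (hx : x ∈ Set.Ioo (0 : ℝ) 1) :
    (eisP x).re ^ 2 =
      (x * eulerF (x ^ 5) ^ 5 / eulerF x) ^ 2 * (125 + 22 * uF x + uF x ^ 2) := by
  have hx' := Ioo_mem_Ico hx
  have h5 := ofReal_eulerF_of_mem (pow_five_mem_Ico hx')
  push_cast at h5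
  have h := defectC_eq_zero (norm_ofReal_lt_one hx')
  rw [defectC, ← ofReal_eulerF_of_mem hx', ← h5, (hasDerivAt_uF_and_ofReal_eisP hx).2] at h
  norm_cast at h
  have p1 := eulerF_pos hx'
  have p5 := eulerF_pos (pow_five_mem_Ico hx')
  have := hx.1
  rw [sub_eq_zero, div_eq_iff (by positivity)] at h
  rw [h, uF]
  field_simp
  ring

lemma eisP_re_pos {x : ℝ} (hx : x ∈ Set.Ico (0 : ℝ) 1) : 0 < (eisP x).re := by
  have h0 : eisP 0 = 1 := by simp [eisP]
  refine pos_of_continuousOn_of_ne_zero (g := fun x : ℝ ↦ (eisP x).re)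
    (continuousOn_re_comp_ofReal fun q hq ↦ differentiableAt_eisP hq) ?_ ?_ hx
  · simp [h0]
  · intro y hy hy0
    rcases hy.1.eq_or_lt with rfl | hpos
    · simp [h0] at hy0
    · have h := eisP_re_sq ⟨hpos, hy.2⟩
      have p1 := eulerF_pos hy
      have p5 := eulerF_pos (pow_five_mem_Ico hy)
      have pu := uF_pos ⟨hpos, hy.2⟩
      rw [hy0] at h
      have : 0 < (y * eulerF (y ^ 5) ^ 5 / eulerF y) ^ 2 * (125 + 22 * uF y + uF y ^ 2) := by
        positivity
      linarith

lemma eisP_re_eq {x : ℝ} (hx : x ∈ Set.Ioo (0 : ℝ) 1) :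
    (eisP x).re =
      x * eulerF (x ^ 5) ^ 5 / eulerF x * Real.sqrt (125 + 22 * uF x + uF x ^ 2) := by
  have p1 := eulerF_pos (Ioo_mem_Ico hx)
  have p5 := eulerF_pos (pow_five_mem_Ico (Ioo_mem_Ico hx))
  have pu := uF_pos hx
  have := hx.1
  rw [← sq_eq_sq₀ (eisP_re_pos (Ioo_mem_Ico hx)).le (by positivity), mul_pow,
    Real.sq_sqrt (by positivity), eisP_re_sq hx]

lemma integrand_eq (k : ℝ) {x : ℝ} (hx : x ∈ Set.Ioo (0 : ℝ) 1) :
    eulerF (x ^ 5) ^ (5 - 6 * k) * eulerF x ^ (6 * k - 1) * x ^ (-k) =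
      -(uF x ^ (k - 1) / Real.sqrt (125 + 22 * uF x + uF x ^ 2) *
        -(uF x * (eisP x).re / x)) := by
  have p1 := eulerF_pos (Ioo_mem_Ico hx)
  have p5 := eulerF_pos (pow_five_mem_Ico (Ioo_mem_Ico hx))
  have pu := uF_pos hx
  have px := hx.1
  have hs : 0 < Real.sqrt (125 + 22 * uF x + uF x ^ 2) := by positivity
  have hk : uF x ^ k = eulerF x ^ (6 * k) / (x ^ k * eulerF (x ^ 5) ^ (6 * k)) := by
    rw [uF, Real.div_rpow (by positivity) (by positivity), Real.mul_rpow px.le (by positivity),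
      ← Real.rpow_natCast_mul p1.le, ← Real.rpow_natCast_mul p5.le]
    norm_cast
  rw [eisP_re_eq hx, Real.rpow_sub_one pu.ne', hk, Real.rpow_sub p5, Real.rpow_sub_one p1.ne',
    Real.rpow_neg px.le, show (5 : ℝ) = ((5 : ℕ) : ℝ) by norm_num, Real.rpow_natCast]
  field_simp

end

theorem integral_fk_eq (k : ℝ) (a b : ℝ) (ha : 0 < a) (hab : a ≤ b) (hb : b < 1) :
    ∫ q in a..b, eulerF (q ^ 5) ^ (5 - 6 * k) * eulerF q ^ (6 * k - 1) * q ^ (-k) =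
      -∫ x in uF a..uF b, x ^ (k - 1) / Real.sqrt (125 + 22 * x + x ^ 2) := by
  have hI : ∀ x ∈ Set.uIcc a b, x ∈ Set.Ioo (0 : ℝ) 1 := by
    intro x hx
    rw [Set.uIcc_of_le hab] at hx
    exact ⟨ha.trans_le hx.1, hx.2.trans_lt hb⟩
  have hd : ∀ x ∈ Set.uIcc a b, HasDerivAt uF (-(uF x * (eisP x).re / x)) x := fun x hx ↦
    (hasDerivAt_uF_and_ofReal_eisP (hI x hx)).1
  have hu : ContinuousOn uF (Set.uIcc a b) := fun x hx ↦
    (hd x hx).continuousAt.continuousWithinAt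
  have hP : ContinuousOn (fun x : ℝ ↦ (eisP x).re) (Set.uIcc a b) :=
    (continuousOn_re_comp_ofReal fun q hq ↦ differentiableAt_eisP hq).mono
      fun x hx ↦ Ioo_mem_Ico (hI x hx)
  have hd' : ContinuousOn (fun x : ℝ ↦ -(uF x * (eisP x).re / x)) (Set.uIcc a b) :=
    ((hu.mul hP).div continuousOn_id fun x hx ↦ (hI x hx).1.ne').neg
  have hg : ContinuousOn (fun x : ℝ ↦ x ^ (k - 1) / Real.sqrt (125 + 22 * x + x ^ 2))
      (uF '' Set.uIcc a b) := by
    rintro _ ⟨x, hx, rfl⟩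
    have pu := uF_pos (hI x hx)
    refine ContinuousAt.continuousWithinAt (ContinuousAt.div
      (Real.continuousAt_rpow_const _ _ (Or.inl pu.ne')) (by fun_prop) ?_)
    positivity
  rw [← intervalIntegral.integral_comp_mul_deriv'' hu
    (fun x hx ↦ (hd x (Set.Ioo_subset_Icc_self hx)).hasDerivWithinAt) hd' hg,
    ← intervalIntegral.integral_neg]
  exact intervalIntegral.integral_congr fun x hx ↦ integrand_eq k (hI x hx)
end

section
/- Let G : (0,∞) → ℝ be continuous. Then for all real a, b with 0 < a ≤ b < 1, ∫_a^b G(f(-q)^6/(q·f(-q^5)^6)) · f(-q^5)^5 / f(-q) dq = -∫_{u(a)}^{u(b)} G(x) / (x·√(125 + 22x + x²)) dx. -/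
open MeasureTheory Real

section

open Filter Topology Finset

/-- Partial fractions for a proper rational function with simple poles at `(x i)⁻¹`. -/
lemma eval_div_prod_one_sub {ι : Type*} [DecidableEq ι] (s : Finset ι) (x : ι → ℝ)
    (hx : ∀ i ∈ s, x i ≠ 0) (hinj : Set.InjOn x s) (P : Polynomial ℝ) (hP : P.degree < #s)
    (c : ℝ) (hc : ∀ i ∈ s, c * x i ≠ 1) :
    P.eval c / ∏ i ∈ s, (1 - c * x i) =
      ∑ i ∈ s, P.eval (x i)⁻¹ / ((∏ j ∈ s.erase i, (1 - x j / x i)) * (1 - c * x i)) := by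
  set v : ι → ℝ := fun i => (x i)⁻¹ with hv
  have hvinj : Set.InjOn v s := fun i hi j hj h => hinj hi hj (inv_injective h)
  have hcv : ∀ i ∈ s, c ≠ v i := by
    intro i hi h
    exact hc i hi (by rw [h, hv]; exact inv_mul_cancel₀ (hx i hi))
  conv_lhs => rw [Lagrange.eq_interpolate hvinj hP]
  rw [Lagrange.eval_interpolate_not_at_node _ hcv, Lagrange.eval_nodal, mul_sum, sum_div]
  refine sum_congr rfl fun i hi => ?_
  have h1 : ∀ j ∈ s, 1 - c * x j = (-x j) * (c - v j) := by
    intro j hj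
    have := hx j hj
    simp only [hv]; field_simp; ring
  have h2 : ∀ j ∈ s.erase i, 1 - x j / x i = (-x j) * (v i - v j) := by
    intro j hj
    have := hx j (mem_of_mem_erase hj)
    have := hx i hi
    simp only [hv]; field_simp; ring
  rw [prod_congr rfl h1, prod_congr rfl h2, prod_mul_distrib, prod_mul_distrib, h1 i hi,
    Lagrange.nodalWeight, prod_inv_distrib, ← mul_prod_erase s (fun j => -x j) hi]
  have e1 : ∏ j ∈ s, (c - v j) ≠ 0 := prod_ne_zero_iff.2 fun j hj => sub_ne_zero.2 (hcv j hj)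
  have e2 : ∏ j ∈ s.erase i, (v i - v j) ≠ 0 := prod_ne_zero_iff.2 fun j hj =>
    sub_ne_zero.2 fun h => (ne_of_mem_erase hj) (hvinj (mem_of_mem_erase hj) hi h.symm)
  have e3 : ∏ j ∈ s.erase i, (-x j) ≠ 0 := prod_ne_zero_iff.2 fun j hj =>
    neg_ne_zero.2 (hx j (mem_of_mem_erase hj))
  have e4 : c - v i ≠ 0 := sub_ne_zero.2 (hcv i hi)
  have e5 := hx i hi
  have e6 : v i = 1 / x i := by simp [hv]
  field_simp
  rw [e6]

/-- The factor of the residue product at distance `t`. -/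
noncomputable def resFactor (p a b : ℝ) (t : ℤ) : ℝ :=
  (1 - a * p ^ t) * (1 - b * p ^ t) / ((if t = 0 then 1 else 1 - p ^ t) * (1 - a * b * p ^ t))

/-- The factor at `n` of the quotient of theta products. -/
noncomputable def quotFactor (p a b c : ℝ) (n : ℤ) : ℝ :=
  (1 - b * c * p ^ n) * (if n = 0 then 1 else 1 - a * c * p ^ n) /
    ((1 - c * p ^ n) * (1 - a * b * c * p ^ n))

lemma erase_disjSum_inl (I : Finset ℤ) (m : ℤ) :
    (I.disjSum I).erase (Sum.inl m) = (I.erase m).disjSum I := by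
  ext (x | x) <;> simp

lemma erase_disjSum_inr (I : Finset ℤ) (m : ℤ) :
    (I.disjSum I).erase (Sum.inr m) = I.disjSum (I.erase m) := by
  ext (x | x) <;> simp

lemma prod_ite_sub_eq_prod_erase (I : Finset ℤ) {m : ℤ} (hm : m ∈ I) (f : ℤ → ℝ) :
    ∏ n ∈ I, (if n - m = 0 then 1 else f n) = ∏ n ∈ I.erase m, f n := by
  rw [← mul_prod_erase I _ hm]
  simp only [sub_self, if_true, one_mul]
  refine prod_congr rfl fun n hn => ?_
  rw [if_neg (sub_ne_zero.2 (ne_of_mem_erase hn))]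

lemma resFactor_neg {p a b : ℝ} (hp : p ≠ 0) (ha : a ≠ 0) (hb : b ≠ 0)
    (h1 : ∀ n : ℤ, n ≠ 0 → p ^ n ≠ 1) (hab1 : ∀ n : ℤ, a * b * p ^ n ≠ 1) (t : ℤ) :
    (1 - p ^ t / a) * (1 - p ^ t / b) / ((if t = 0 then 1 else 1 - p ^ t) * (1 - p ^ t / (a * b)))
      = (if t = 0 then -1 else 1) * resFactor p a b (-t) := by
  have hz : p ^ t ≠ 0 := zpow_ne_zero _ hp
  have h2 := hab1 (-t)
  rw [zpow_neg] at h2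
  by_cases ht : t = 0
  · subst ht
    simp only [zpow_zero, inv_one, mul_one] at h2
    have h3 : 1 - a * b ≠ 0 := sub_ne_zero.2 h2.symm
    have h4 : a * b - 1 ≠ 0 := sub_ne_zero.2 h2
    simp [resFactor]
    field_simp
    ring
  · have h3 := h1 t ht
    simp only [resFactor, ht, neg_eq_zero, if_false, zpow_neg]
    set z := p ^ t with hzdef
    have h5 : 1 - z ≠ 0 := sub_ne_zero.2 h3.symm
    have h6 : z - 1 ≠ 0 := sub_ne_zero.2 h3
    have h7 : a * b - z ≠ 0 := fun h => h2 (by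
      rw [sub_eq_zero.1 h]; exact mul_inv_cancel₀ hz)
    have h8 : z - a * b ≠ 0 := fun h => h7 (by linarith)
    field_simp
    ring

lemma prod_quotFactor {p a b c : ℝ} (hp : p ≠ 0) (ha : a ≠ 0) (hb : b ≠ 0)
    (h1 : ∀ n : ℤ, n ≠ 0 → p ^ n ≠ 1) (ha1 : ∀ n : ℤ, a * p ^ n ≠ 1) (hb1 : ∀ n : ℤ, b * p ^ n ≠ 1)
    (hab1 : ∀ n : ℤ, a * b * p ^ n ≠ 1) (hc1 : ∀ n : ℤ, c * p ^ n ≠ 1)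
    (habc1 : ∀ n : ℤ, a * b * c * p ^ n ≠ 1) (I : Finset ℤ) (hI : 0 ∈ I) :
    ∏ n ∈ I, quotFactor p a b c n =
      ∑ m ∈ I, ((∏ n ∈ I, resFactor p a b (n - m)) *
          ((1 - c * p ^ m) * (1 - a * (p ^ m)⁻¹))⁻¹ -
        (∏ n ∈ I, resFactor p a b (m - n)) *
          ((1 - a * b * c * p ^ m) * (1 - (p ^ m)⁻¹ / b))⁻¹) := by
  classical
  set x : ℤ ⊕ ℤ → ℝ := Sum.elim (fun n => p ^ n) (fun n => a * b * p ^ n) with hxdef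
  have hz : ∀ n : ℤ, p ^ n ≠ 0 := fun n => zpow_ne_zero _ hp
  have hpinj : ∀ m n : ℤ, p ^ m = p ^ n → m = n := by
    intro m n h
    by_contra hmn
    apply h1 (m - n) (sub_ne_zero.2 hmn)
    rw [zpow_sub₀ hp, h, div_self (hz n)]
  have hcross : ∀ m n : ℤ, p ^ m ≠ a * b * p ^ n := by
    intro m n h
    apply hab1 (n - m)
    rw [zpow_sub₀ hp, ← mul_div_assoc, ← h, div_self (hz m)]
  have hx0 : ∀ i ∈ I.disjSum I, x i ≠ 0 := by
    rintro (n | n) _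
    · exact hz n
    · exact mul_ne_zero (mul_ne_zero ha hb) (hz n)
  have hxinj : Set.InjOn x (I.disjSum I : Finset (ℤ ⊕ ℤ)) := by
    rintro (m | m) _ (n | n) _ h
    · simp only [hxdef, Sum.elim_inl] at h
      rw [hpinj _ _ h]
    · exact absurd h (hcross m n)
    · exact absurd h.symm (hcross n m)
    · simp only [hxdef, Sum.elim_inr] at h
      rw [hpinj _ _ (mul_left_cancel₀ (mul_ne_zero ha hb) h)]
  have hcx : ∀ i ∈ I.disjSum I, c * x i ≠ 1 := by
    rintro (n | n) _
    · exact hc1 n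
    · have := habc1 n
      simp only [hxdef, Sum.elim_inr]
      intro h; apply this; rw [← h]; ring
  set P : Polynomial ℝ := (∏ n ∈ I, (1 - Polynomial.C (b * p ^ n) * Polynomial.X)) *
    ∏ n ∈ I.erase 0, (1 - Polynomial.C (a * p ^ n) * Polynomial.X) with hPdef
  have hPe : ∀ y, P.eval y = (∏ n ∈ I, (1 - b * p ^ n * y)) *
      ∏ n ∈ I.erase 0, (1 - a * p ^ n * y) := by
    intro y; simp [hPdef, Polynomial.eval_prod]
  have hlin : ∀ r : ℝ, (1 - Polynomial.C r * Polynomial.X : Polynomial ℝ).natDegree ≤ 1 := by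
    intro r
    compute_degree
  have hPd : P.degree < #(I.disjSum I) := by
    refine lt_of_le_of_lt Polynomial.degree_le_natDegree ?_
    rw [card_disjSum]
    have e1 : (∏ n ∈ I, (1 - Polynomial.C (b * p ^ n) * Polynomial.X)).natDegree ≤ #I :=
      (Polynomial.natDegree_prod_le _ _).trans ((sum_le_card_nsmul _ _ 1 fun n _ => hlin _).trans
        (by simp))
    have e2 : (∏ n ∈ I.erase 0, (1 - Polynomial.C (a * p ^ n) * Polynomial.X)).natDegree
        ≤ #(I.erase 0) :=
      (Polynomial.natDegree_prod_le _ _).trans ((sum_le_card_nsmul _ _ 1 fun n _ => hlin _).trans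
        (by simp))
    have e3 : #(I.erase 0) < #I := card_erase_lt_of_mem hI
    have e4 : P.natDegree ≤ _ := Polynomial.natDegree_mul_le
    exact_mod_cast (by omega : P.natDegree < #I + #I)
  have key := eval_div_prod_one_sub (I.disjSum I) x hx0 hxinj P hPd c hcx
  rw [prod_disjSum, sum_disjSum, ← sum_add_distrib] at key
  have hL : P.eval c / ((∏ n ∈ I, (1 - c * x (Sum.inl n))) * ∏ n ∈ I, (1 - c * x (Sum.inr n)))
      = ∏ n ∈ I, quotFactor p a b c n := by
    simp only [quotFactor]
    rw [prod_div_distrib, prod_mul_distrib, prod_mul_distrib, hPe]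
    have := prod_ite_sub_eq_prod_erase I hI (fun n => 1 - a * c * p ^ n)
    simp only [sub_zero] at this
    rw [this]
    simp only [hxdef, Sum.elim_inl, Sum.elim_inr]
    congr 1
    · congr 1 <;> exact prod_congr rfl fun n _ => by ring
    · congr 1; exact prod_congr rfl fun n _ => by ring
  rw [hL] at key
  rw [key]
  refine sum_congr rfl fun m hm => ?_
  rw [sub_eq_add_neg]
  congr 1
  · rw [erase_disjSum_inl, prod_disjSum, hPe]
    simp only [hxdef, Sum.elim_inl, Sum.elim_inr]
    have hd : ∏ n ∈ I, resFactor p a b (n - m) =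
        ((∏ n ∈ I, (1 - a * p ^ n * (p ^ m)⁻¹)) * ∏ n ∈ I, (1 - b * p ^ n * (p ^ m)⁻¹)) /
        ((∏ n ∈ I.erase m, (1 - p ^ n / p ^ m)) * ∏ n ∈ I, (1 - a * b * p ^ n / p ^ m)) := by
      rw [← prod_ite_sub_eq_prod_erase I hm, ← prod_mul_distrib, ← prod_mul_distrib,
        ← prod_div_distrib]
      refine prod_congr rfl fun n _ => ?_
      simp only [resFactor, zpow_sub₀ hp]
      congr 1
      · ring
      · congr 1; ring
    rw [hd, ← mul_prod_erase I (fun n => 1 - a * p ^ n * (p ^ m)⁻¹) hI]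
    simp only [zpow_zero, mul_one]
    have ne1 : 1 - a * (p ^ m)⁻¹ ≠ 0 := by
      have := ha1 (-m); rw [zpow_neg] at this; exact sub_ne_zero.2 this.symm
    have ne2 : 1 - c * p ^ m ≠ 0 := sub_ne_zero.2 (hc1 m).symm
    set A1 := ∏ n ∈ I.erase 0, (1 - a * p ^ n * (p ^ m)⁻¹)
    set A2 := ∏ n ∈ I, (1 - b * p ^ n * (p ^ m)⁻¹)
    set A3 := ∏ n ∈ I.erase m, (1 - p ^ n / p ^ m)
    set A4 := ∏ n ∈ I, (1 - a * b * p ^ n / p ^ m)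
    set w := 1 - a * (p ^ m)⁻¹
    set w2 := 1 - c * p ^ m with hw2
    have hw3 : 1 + -(c * p ^ m) = w2 := by rw [hw2]; ring
    field_simp
    rw [hw3]
    field_simp
  · rw [erase_disjSum_inr, prod_disjSum, hPe]
    simp only [hxdef, Sum.elim_inl, Sum.elim_inr]
    have hsign : ∏ n ∈ I, (if n - m = 0 then (-1 : ℝ) else 1) = -1 := by
      rw [← mul_prod_erase I _ hm]
      simp only [sub_self, if_true]
      rw [prod_congr rfl (g := fun _ => (1 : ℝ)) fun n hn => ?_]
      · simp
      · rw [if_neg (sub_ne_zero.2 (ne_of_mem_erase hn))]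
    have hd : -∏ n ∈ I, resFactor p a b (m - n) =
        ((∏ n ∈ I, (1 - a * p ^ n * (a * b * p ^ m)⁻¹)) *
          ∏ n ∈ I, (1 - b * p ^ n * (a * b * p ^ m)⁻¹)) /
        ((∏ n ∈ I, (1 - p ^ n / (a * b * p ^ m))) *
          ∏ n ∈ I.erase m, (1 - a * b * p ^ n / (a * b * p ^ m))) := by
      rw [neg_eq_neg_one_mul, ← hsign, ← prod_ite_sub_eq_prod_erase I hm, ← prod_mul_distrib,
        ← prod_mul_distrib, ← prod_mul_distrib, ← prod_div_distrib]
      refine prod_congr rfl fun n _ => ?_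
      have := resFactor_neg hp ha hb h1 hab1 (n - m)
      rw [neg_sub] at this
      rw [← this, zpow_sub₀ hp]
      have := hz m
      congr 1
      · field_simp
      · rw [mul_comm]
        congr 1
        · field_simp
        · congr 1; field_simp
    rw [← neg_mul, hd, ← mul_prod_erase I (fun n => 1 - a * p ^ n * (a * b * p ^ m)⁻¹) hI]
    simp only [zpow_zero, mul_one]
    have e0 : 1 - a * (a * b * p ^ m)⁻¹ = 1 - (p ^ m)⁻¹ / b := by
      have := hz m
      field_simp
    rw [e0]
    have ne1 : 1 - (p ^ m)⁻¹ / b ≠ 0 := by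
      have := hb1 m
      have h3 := hz m
      intro h
      apply this
      field_simp at h
      linarith
    have ne2 : 1 - c * (a * b * p ^ m) ≠ 0 := by
      refine sub_ne_zero.2 fun h => habc1 m ?_
      rw [h]; ring
    have e1 : 1 - a * b * c * p ^ m = 1 - c * (a * b * p ^ m) := by ring
    rw [e1]
    set A1 := ∏ n ∈ I.erase 0, (1 - a * p ^ n * (a * b * p ^ m)⁻¹)
    set A2 := ∏ n ∈ I, (1 - b * p ^ n * (a * b * p ^ m)⁻¹)
    set A3 := ∏ n ∈ I, (1 - p ^ n / (a * b * p ^ m))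
    set A4 := ∏ n ∈ I.erase m, (1 - a * b * p ^ n / (a * b * p ^ m))
    set w := 1 - (p ^ m)⁻¹ / b
    set w2 := 1 - c * (a * b * p ^ m)
    field_simp

lemma summable_zpow_div_mul {p : ℝ} (hp0 : 0 < p) (hp1 : p < 1) {α β : ℝ} (hα : α ≠ 0)
    (hβ : β ≠ 0) : Summable fun n : ℤ => p ^ n / ((1 - α * p ^ n) * (1 - β * p ^ n)) := by
  have hg : Summable fun n : ℕ => p ^ n := summable_geometric_of_lt_one hp0.le hp1
  have ht : Tendsto (fun n : ℕ => p ^ n) atTop (𝓝 0) :=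
    tendsto_pow_atTop_nhds_zero_of_lt_one hp0.le hp1
  refine Summable.of_nat_of_neg ?_ ?_
  · refine summable_of_isBigO_nat hg ?_
    have h1 : Tendsto (fun n : ℕ => ((1 - α * p ^ n) * (1 - β * p ^ n))⁻¹) atTop
        (𝓝 ((1 - α * 0) * (1 - β * 0))⁻¹) :=
      (((ht.const_mul α).const_sub 1).mul ((ht.const_mul β).const_sub 1)).inv₀ (by simp)
    simpa [div_eq_mul_inv] using (Asymptotics.isBigO_refl (fun n : ℕ => p ^ n) atTop).mul
      (h1.isBigO_one ℝ)
  · refine summable_of_isBigO_nat hg ?_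
    have h1 : Tendsto (fun n : ℕ => ((p ^ n - α) * (p ^ n - β))⁻¹) atTop
        (𝓝 ((0 - α) * (0 - β))⁻¹) :=
      ((ht.sub_const α).mul (ht.sub_const β)).inv₀ (by simp [hα, hβ])
    have h2 := (Asymptotics.isBigO_refl (fun n : ℕ => p ^ n) atTop).mul (h1.isBigO_one ℝ)
    simp only [mul_one] at h2
    refine h2.congr_left fun n => ?_
    have hz : p ^ n ≠ 0 := (pow_pos hp0 n).ne'
    rw [zpow_neg, zpow_natCast]
    have e1 : 1 - α * (p ^ n)⁻¹ = (p ^ n - α) / p ^ n := by field_simp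
    have e2 : 1 - β * (p ^ n)⁻¹ = (p ^ n - β) / p ^ n := by field_simp
    rw [e1, e2, ← div_eq_mul_inv]
    field_simp

lemma summable_resFactor_sub_one {p a b : ℝ} (hp0 : 0 < p) (hp1 : p < 1) (ha : a ≠ 0) (hb : b ≠ 0)
    (hab1 : ∀ n : ℤ, a * b * p ^ n ≠ 1) : Summable fun t => ‖resFactor p a b t - 1‖ := by
  have h := (summable_zpow_div_mul hp0 hp1 one_ne_zero (mul_ne_zero ha hb)).mul_left
    ((1 - a) * (1 - b))
  refine Summable.norm ((summable_congr_cofinite ?_).1 h)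
  have : ∀ᶠ t : ℤ in cofinite, t ≠ 0 := by
    simpa using (Set.finite_singleton (0 : ℤ)).eventually_cofinite_notMem
  filter_upwards [this] with t ht
  have h1 : 1 - p ^ t ≠ 0 := by
    refine sub_ne_zero.2 fun h => ht ?_
    exact (zpow_eq_one_iff_right₀ hp0.le hp1.ne).1 h.symm
  have h2 : 1 - a * b * p ^ t ≠ 0 := sub_ne_zero.2 (hab1 t).symm
  simp only [resFactor, ht, if_false, one_mul]
  set z := p ^ t
  field_simp
  ring

lemma HasProd.tendsto_prod_Icc_neg {f : ℤ → ℝ} {R : ℝ} (h : HasProd f R) :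
    Tendsto (fun N : ℕ => ∏ n ∈ Icc (-(N : ℤ)) N, f n) atTop (𝓝 R) := by
  have h1 : Tendsto (fun s : Finset ℤ => ∏ n ∈ s, f n) atTop (𝓝 R) := by
    simpa [HasProd] using h
  exact h1.comp (tendsto_Icc_neg (R := ℤ))

lemma tendsto_prod_resFactor {p a b R : ℝ} (h : HasProd (resFactor p a b) R) (m : ℤ) :
    Tendsto (fun N : ℕ => ∏ n ∈ Icc (-(N : ℤ)) N, resFactor p a b (n - m)) atTop (𝓝 R) ∧
    Tendsto (fun N : ℕ => ∏ n ∈ Icc (-(N : ℤ)) N, resFactor p a b (m - n)) atTop (𝓝 R) := by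
  have h1 : HasProd (fun n => resFactor p a b (n - m)) R :=
    (Equiv.hasProd_iff (f := resFactor p a b) (a := R) (Equiv.subRight m)).2 h
  have h2 : HasProd (fun n => resFactor p a b (m - n)) R :=
    (Equiv.hasProd_iff (f := resFactor p a b) (a := R) (Equiv.subLeft m)).2 h
  exact ⟨h1.tendsto_prod_Icc_neg, h2.tendsto_prod_Icc_neg⟩

lemma exists_bound_prod_resFactor {p a b : ℝ} (hs : Summable fun t => ‖resFactor p a b t - 1‖) :
    ∃ K : ℝ, 0 ≤ K ∧ ∀ (I : Finset ℤ) (e : ℤ → ℤ), Function.Injective e →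
      ‖∏ n ∈ I, resFactor p a b (e n)‖ ≤ K := by
  refine ⟨Real.exp (∑' t, ‖resFactor p a b t - 1‖), (Real.exp_pos _).le, fun I e he => ?_⟩
  rw [norm_prod]
  calc ∏ n ∈ I, ‖resFactor p a b (e n)‖ ≤ ∏ n ∈ I, (1 + ‖resFactor p a b (e n) - 1‖) := by
        refine prod_le_prod (fun _ _ => norm_nonneg _) fun n _ => ?_
        calc ‖resFactor p a b (e n)‖ = ‖1 + (resFactor p a b (e n) - 1)‖ := by ring_nf
          _ ≤ ‖(1 : ℝ)‖ + ‖resFactor p a b (e n) - 1‖ := norm_add_le _ _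
          _ = _ := by simp
    _ ≤ Real.exp (∑ n ∈ I, ‖resFactor p a b (e n) - 1‖) :=
        Real.prod_one_add_le_exp_sum _ fun _ => norm_nonneg _
    _ ≤ _ := by
        refine Real.exp_le_exp.2 ?_
        rw [← sum_image (f := fun t => ‖resFactor p a b t - 1‖) (fun x _ y _ h => he h)]
        exact hs.sum_le_tsum _ fun _ _ => norm_nonneg _

/-- Partial fraction expansion of a quotient of theta products with two series of poles. -/
theorem tprod_quotFactor {p a b c L R : ℝ} (hp0 : 0 < p) (hp1 : p < 1) (ha : a ≠ 0) (hb : b ≠ 0)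
    (hc : c ≠ 0) (ha1 : ∀ n : ℤ, a * p ^ n ≠ 1) (hb1 : ∀ n : ℤ, b * p ^ n ≠ 1)
    (hab1 : ∀ n : ℤ, a * b * p ^ n ≠ 1) (hc1 : ∀ n : ℤ, c * p ^ n ≠ 1)
    (habc1 : ∀ n : ℤ, a * b * c * p ^ n ≠ 1)
    (hL : HasProd (quotFactor p a b c) L) (hR : HasProd (resFactor p a b) R) :
    L = R * ∑' m : ℤ, (((1 - c * p ^ m) * (1 - a * (p ^ m)⁻¹))⁻¹ -
      ((1 - a * b * c * p ^ m) * (1 - (p ^ m)⁻¹ / b))⁻¹) := by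
  have h1 : ∀ n : ℤ, n ≠ 0 → p ^ n ≠ 1 := fun n hn h =>
    hn ((zpow_eq_one_iff_right₀ hp0.le hp1.ne).1 h)
  set S : ℤ → ℝ := fun m => ((1 - c * p ^ m) * (1 - a * (p ^ m)⁻¹))⁻¹ with hS
  set T : ℤ → ℝ := fun m => ((1 - a * b * c * p ^ m) * (1 - (p ^ m)⁻¹ / b))⁻¹ with hT
  have hSs : Summable S := by
    refine ((summable_zpow_div_mul hp0 hp1 hc (inv_ne_zero ha)).mul_left (-a⁻¹)).congr fun m => ?_
    have hz : p ^ m ≠ 0 := (zpow_pos hp0 m).ne'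
    have e : 1 - a * (p ^ m)⁻¹ = -a * (1 - a⁻¹ * p ^ m) / p ^ m := by field_simp; ring
    simp only [hS, e]
    rw [div_eq_mul_inv, mul_inv, mul_inv, div_eq_mul_inv, mul_inv, mul_inv, inv_inv, inv_neg]
    ring
  have hTs : Summable T := by
    refine ((summable_zpow_div_mul hp0 hp1 (mul_ne_zero (mul_ne_zero ha hb) hc) hb).mul_left
      (-b)).congr fun m => ?_
    have hz : p ^ m ≠ 0 := (zpow_pos hp0 m).ne'
    have e : 1 - (p ^ m)⁻¹ / b = -(1 - b * p ^ m) / (b * p ^ m) := by field_simp; ring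
    simp only [hT, e]
    simp only [div_eq_mul_inv, mul_inv, inv_inv, inv_neg]
    ring
  obtain ⟨K, hK0, hK⟩ := exists_bound_prod_resFactor
    (summable_resFactor_sub_one hp0 hp1 ha hb hab1)
  have lim1 : Tendsto (fun N : ℕ => ∏ n ∈ Icc (-(N : ℤ)) N, quotFactor p a b c n) atTop (𝓝 L) :=
    hL.tendsto_prod_Icc_neg
  rw [← tsum_mul_left]
  refine tendsto_nhds_unique lim1 ?_
  set F : ℕ → ℤ → ℝ := fun N m => if m ∈ Icc (-(N : ℤ)) N then
    (∏ n ∈ Icc (-(N : ℤ)) N, resFactor p a b (n - m)) * S m -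
    (∏ n ∈ Icc (-(N : ℤ)) N, resFactor p a b (m - n)) * T m else 0 with hF
  have hsum : ∀ N : ℕ, ∏ n ∈ Icc (-(N : ℤ)) N, quotFactor p a b c n = ∑' m, F N m := by
    intro N
    rw [prod_quotFactor hp0.ne' ha hb h1 ha1 hb1 hab1 hc1 habc1 _ (by simp),
      tsum_eq_sum (s := Icc (-(N : ℤ)) N) (fun m hm => by simp only [hF, hm, if_false])]
    exact sum_congr rfl fun m hm => by simp only [hF, hm, if_true, hS, hT]
  simp_rw [hsum]
  refine tendsto_tsum_of_dominated_convergence (bound := fun m => K * ‖S m‖ + K * ‖T m‖)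
    ((hSs.norm.mul_left K).add (hTs.norm.mul_left K)) (fun m => ?_) (Eventually.of_forall ?_)
  · obtain ⟨l1, l2⟩ := tendsto_prod_resFactor hR m
    have := (l1.mul_const (S m)).sub (l2.mul_const (T m))
    rw [mul_sub]
    refine this.congr' ?_
    filter_upwards [eventually_ge_atTop m.natAbs] with N hN
    have : m ∈ Icc (-(N : ℤ)) N := by simp only [mem_Icc]; omega
    simp only [hF, this, if_true]
  · intro N m
    by_cases hm : m ∈ Icc (-(N : ℤ)) N
    · simp only [hF, hm, if_true]
      refine (norm_sub_le _ _).trans ?_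
      rw [norm_mul, norm_mul]
      gcongr
      · exact hK _ _ (sub_left_injective)
      · exact hK _ _ (sub_right_injective)
    · simp only [hF, hm, if_false, norm_zero]
      positivity

/-- The infinite `q`-Pochhammer symbol `(x; p)_∞`. -/
noncomputable def qPoch (p x : ℝ) : ℝ := ∏' n : ℕ, (1 - x * p ^ n)

/-- The modified Jacobi theta function `(x; p)_∞ (p / x; p)_∞`. -/
noncomputable def qTheta (p x : ℝ) : ℝ := qPoch p x * qPoch p (p / x)

/-- The Lambert series `∑ x pⁿ / (1 - x pⁿ)`. -/
noncomputable def lambert (p x : ℝ) : ℝ := ∑' n : ℕ, x * p ^ n / (1 - x * p ^ n)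

/-- The Lambert series `∑ x pⁿ / (1 - x pⁿ)²`. -/
noncomputable def lambertSq (p x : ℝ) : ℝ := ∑' n : ℕ, x * p ^ n / (1 - x * p ^ n) ^ 2

/-- The odd part of the Lambert series. -/
noncomputable def lambertOdd (p x : ℝ) : ℝ := lambert p x - lambert p (p / x)

section

variable {p : ℝ} (hp0 : 0 < p) (hp1 : p < 1)

include hp0 hp1

lemma summable_norm_neg_mul_pow (x : ℝ) : Summable fun n : ℕ => ‖-(x * p ^ n)‖ := by
  simp only [norm_neg]
  exact ((summable_geometric_of_lt_one hp0.le hp1).mul_left x).norm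

lemma hasProd_qPoch (x : ℝ) : HasProd (fun n : ℕ => 1 - x * p ^ n) (qPoch p x) := by
  have := multipliable_one_add_of_summable (summable_norm_neg_mul_pow hp0 hp1 x)
  simp only [← sub_eq_add_neg] at this
  exact this.hasProd

lemma qPoch_ne_zero {x : ℝ} (hx : ∀ n : ℕ, x * p ^ n ≠ 1) : qPoch p x ≠ 0 := by
  have := tprod_one_add_ne_zero_of_summable (f := fun n : ℕ => -(x * p ^ n))
    (fun n => by rw [← sub_eq_add_neg]; exact sub_ne_zero.2 (hx n).symm)
    (summable_norm_neg_mul_pow hp0 hp1 x)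
  simp only [← sub_eq_add_neg] at this
  exact this

lemma hasProd_qPoch_mul (y : ℝ) :
    HasProd (fun n : ℕ => if n = 0 then 1 else 1 - y * p ^ n) (qPoch p (p * y)) := by
  have h := HasProd.zero_mul (f := fun n : ℕ => if n = 0 then 1 else 1 - y * p ^ n)
    (m := qPoch p (p * y)) ((hasProd_qPoch hp0 hp1 (p * y)).congr_fun fun n => by
      simp only [Nat.add_eq_zero_iff, one_ne_zero, and_false, if_false]; ring)
  simpa using h

lemma qPoch_eq_mul (x : ℝ) : qPoch p x = (1 - x) * qPoch p (p * x) := by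
  have h := HasProd.zero_mul (f := fun n : ℕ => 1 - x * p ^ n)
    (m := qPoch p (p * x)) (by
      convert hasProd_qPoch hp0 hp1 (p * x) using 2 with n
      ring)
  simpa using (hasProd_qPoch hp0 hp1 x).unique h

lemma qTheta_mul {x : ℝ} (hx : x ≠ 0) : qTheta p (p * x) = -qTheta p x / x := by
  have h1 := qPoch_eq_mul hp0 hp1 x
  have h2 := qPoch_eq_mul hp0 hp1 (1 / x)
  have e1 : p / (p * x) = 1 / x := by have := hp0.ne'; field_simp
  have e2 : p * (1 / x) = p / x := by ring
  rw [e2] at h2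
  rw [qTheta, qTheta, e1, h1, h2]
  field_simp
  ring

lemma qTheta_inv {x : ℝ} (hx : x ≠ 0) : qTheta p x⁻¹ = -qTheta p x / x := by
  rw [← qTheta_mul hp0 hp1 hx, qTheta, qTheta]
  have e1 : p / (p * x) = x⁻¹ := by have := hp0.ne'; field_simp
  rw [e1, div_inv_eq_mul, mul_comm]

lemma qTheta_ne_zero {x : ℝ} (hx : x ≠ 0) (h : ∀ n : ℤ, x * p ^ n ≠ 1) : qTheta p x ≠ 0 := by
  refine mul_ne_zero (qPoch_ne_zero hp0 hp1 fun n => ?_) (qPoch_ne_zero hp0 hp1 fun n hn => ?_)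
  · exact_mod_cast h n
  · apply h (-(n + 1 : ℕ))
    have := pow_pos hp0 n
    rw [zpow_neg, zpow_natCast, pow_succ]
    field_simp at hn ⊢
    linarith

/-- A quotient of theta functions as a product over the integers. -/
lemma hasProd_int_quot {x y z w : ℝ} (hx : x ≠ 0) (hy : y ≠ 0) (hz : z ≠ 0) (hw : w ≠ 0)
    (hxy : x * y = z * w) (hz1 : ∀ n : ℤ, z * p ^ n ≠ 1) (hw1 : ∀ n : ℤ, w * p ^ n ≠ 1) :
    HasProd (fun n : ℤ => (1 - x * p ^ n) * (if n = 0 then 1 else 1 - y * p ^ n) /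
      ((1 - z * p ^ n) * (1 - w * p ^ n)))
      (qTheta p x * (qPoch p (p * y) * qPoch p (p / y)) / (qTheta p z * qTheta p w)) := by
  have hzz := qTheta_ne_zero hp0 hp1 hz hz1
  have hww := qTheta_ne_zero hp0 hp1 hw hw1
  have n1 := left_ne_zero_of_mul hzz
  have n2 := right_ne_zero_of_mul hzz
  have n3 := left_ne_zero_of_mul hww
  have n4 := right_ne_zero_of_mul hww
  have H1 := ((hasProd_qPoch hp0 hp1 x).mul (hasProd_qPoch_mul hp0 hp1 y)).div₀
    ((hasProd_qPoch hp0 hp1 z).mul (hasProd_qPoch hp0 hp1 w)) (mul_ne_zero n1 n3)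
  have H2 := ((hasProd_qPoch hp0 hp1 (p / x)).mul (hasProd_qPoch hp0 hp1 (p / y))).div₀
    ((hasProd_qPoch hp0 hp1 (p / z)).mul (hasProd_qPoch hp0 hp1 (p / w))) (mul_ne_zero n2 n4)
  have key : ∀ (n : ℕ) (x : ℝ), x ≠ 0 →
      1 - x * p ^ (-((n : ℤ) + 1)) = -(x * (p ^ (n + 1))⁻¹) * (1 - p / x * p ^ n) := by
    intro n x hx
    have : p ^ (-((n : ℤ) + 1)) = (p ^ (n + 1))⁻¹ := by
      rw [zpow_neg]; norm_cast
    rw [this, pow_succ]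
    have := pow_pos hp0 n
    field_simp
    ring
  have H := HasProd.of_nat_of_neg_add_one (f := fun n : ℤ =>
      (1 - x * p ^ n) * (if n = 0 then 1 else 1 - y * p ^ n) /
      ((1 - z * p ^ n) * (1 - w * p ^ n)))
    (H1.congr_fun fun n => by simp only [zpow_natCast, Nat.cast_eq_zero])
    (H2.congr_fun fun n => by
      have hn : -((n : ℤ) + 1) ≠ 0 := by lia
      have hpn := pow_pos hp0 (n + 1)
      rw [if_neg hn, key n x hx, key n y hy, key n z hz, key n w hw]
      have e : ∀ A B C D r : ℝ, r ≠ 0 → (-(x * r) * A * (-(y * r) * B)) /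
          (-(z * r) * C * (-(w * r) * D)) = A * B / (C * D) := by
        intro A B C D r hr
        have h3 : -(x * r) * A * (-(y * r) * B) = (x * y * r ^ 2) * (A * B) := by ring
        have h4 : -(z * r) * C * (-(w * r) * D) = (x * y * r ^ 2) * (C * D) := by
          rw [hxy]; ring
        rw [h3, h4, mul_div_mul_left _ _ (by positivity)]
      exact e _ _ _ _ _ (inv_ne_zero hpn.ne'))
  convert H using 1
  simp only [qTheta]
  field_simp

end

section

variable {p : ℝ} (hp0 : 0 < p) (hp1 : p < 1)

include hp0 hp1

lemma summable_mul_pow_div_pow (x : ℝ) (k : ℕ) :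
    Summable fun n : ℕ => x * p ^ n / (1 - x * p ^ n) ^ k := by
  have ht : Tendsto (fun n : ℕ => p ^ n) atTop (𝓝 0) :=
    tendsto_pow_atTop_nhds_zero_of_lt_one hp0.le hp1
  refine summable_of_isBigO_nat ((summable_geometric_of_lt_one hp0.le hp1).mul_left x) ?_
  have h1 : Tendsto (fun n : ℕ => ((1 - x * p ^ n) ^ k)⁻¹) atTop (𝓝 ((1 - x * 0) ^ k)⁻¹) :=
    (((ht.const_mul x).const_sub 1).pow k).inv₀ (by simp)
  simpa [div_eq_mul_inv] using (Asymptotics.isBigO_refl (fun n : ℕ => x * p ^ n) atTop).mul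
    (h1.isBigO_one ℝ)

lemma hasSum_lambert (x : ℝ) :
    HasSum (fun n : ℕ => x * p ^ n / (1 - x * p ^ n)) (lambert p x) := by
  have := (summable_mul_pow_div_pow hp0 hp1 x 1).hasSum
  simp only [pow_one] at this
  exact this

lemma hasSum_lambertSq (x : ℝ) :
    HasSum (fun n : ℕ => x * p ^ n / (1 - x * p ^ n) ^ 2) (lambertSq p x) :=
  (summable_mul_pow_div_pow hp0 hp1 x 2).hasSum

lemma lambert_eq_add (x : ℝ) : lambert p x = x / (1 - x) + lambert p (p * x) := by
  have h := HasSum.zero_add (f := fun n : ℕ => x * p ^ n / (1 - x * p ^ n))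
    (m := lambert p (p * x)) ((hasSum_lambert hp0 hp1 (p * x)).congr_fun fun n => by ring_nf)
  simpa using (hasSum_lambert hp0 hp1 x).unique h

lemma lambertOdd_inv {x : ℝ} (hx : x ≠ 0) (h1 : x ≠ 1) :
    lambertOdd p x⁻¹ = -lambertOdd p x - 1 := by
  have e1 : p / x⁻¹ = p * x := by field_simp
  have e2 := lambert_eq_add hp0 hp1 x
  have e3 := lambert_eq_add hp0 hp1 x⁻¹
  have e4 : p * x⁻¹ = p / x := by ring
  have e5 : x / (1 - x) + x⁻¹ / (1 - x⁻¹) = -1 := by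
    have h2 : 1 - x ≠ 0 := sub_ne_zero.2 h1.symm
    have h3 : x - 1 ≠ 0 := sub_ne_zero.2 h1
    have : x⁻¹ / (1 - x⁻¹) = 1 / (x - 1) := by field_simp
    rw [this, div_add_div _ _ h2 h3, div_eq_iff (mul_ne_zero h2 h3)]
    ring
  rw [lambertOdd, lambertOdd, e1, e3, e4, e2]
  linear_combination e5

lemma lambertOdd_mul {x : ℝ} (hx : x ≠ 0) (h1 : x ≠ 1) :
    lambertOdd p (p * x) = lambertOdd p x + 1 := by
  have e := lambertOdd_inv hp0 hp1 hx h1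
  have e1 : p / (p * x) = x⁻¹ := by have := hp0.ne'; field_simp
  have e2 : p / x⁻¹ = p * x := by field_simp
  rw [lambertOdd, e2] at e
  rw [lambertOdd, e1]
  linear_combination -e

omit hp1 in
lemma inv_one_sub_mul_zpow_neg {x : ℝ} (hx : x ≠ 0) (h : ∀ n : ℤ, x * p ^ n ≠ 1) (n : ℕ) :
    (1 - x * p ^ (-((n : ℤ) + 1)))⁻¹ = -(p / x * p ^ n / (1 - p / x * p ^ n)) := by
  have h1 := h (-((n : ℤ) + 1))
  have e : p ^ (-((n : ℤ) + 1)) = (p ^ (n + 1))⁻¹ := by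
    rw [zpow_neg]; norm_cast
  rw [e] at h1 ⊢
  have e2 : p / x * p ^ n = p ^ (n + 1) / x := by rw [pow_succ]; ring
  have hr := (pow_pos hp0 (n + 1)).ne'
  rw [e2]
  set r := p ^ (n + 1)
  have h2 : r - x ≠ 0 := by
    intro h; apply h1; rw [← sub_eq_zero.1 h]; exact mul_inv_cancel₀ hr
  have h3 : x - r ≠ 0 := by rw [← neg_sub]; exact neg_ne_zero.2 h2
  have e3 : 1 - x * r⁻¹ = (r - x) / r := by field_simp
  have e4 : 1 - r / x = (x - r) / x := by field_simp
  rw [e3, e4, inv_div, div_div_div_cancel_right₀ hx, ← neg_sub x r, div_neg]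

lemma hasSum_int_inv_sub_inv {x y : ℝ} (hx : x ≠ 0) (hy : y ≠ 0)
    (hx1 : ∀ n : ℤ, x * p ^ n ≠ 1) (hy1 : ∀ n : ℤ, y * p ^ n ≠ 1) :
    HasSum (fun n : ℤ => (1 - x * p ^ n)⁻¹ - (1 - y * p ^ n)⁻¹)
      (lambertOdd p x - lambertOdd p y) := by
  have H1 := (hasSum_lambert hp0 hp1 x).sub (hasSum_lambert hp0 hp1 y)
  have H2 := (hasSum_lambert hp0 hp1 (p / x)).neg.sub (hasSum_lambert hp0 hp1 (p / y)).neg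
  have H := HasSum.of_nat_of_neg_add_one (f := fun n : ℤ => (1 - x * p ^ n)⁻¹ - (1 - y * p ^ n)⁻¹)
    (H1.congr_fun fun n => by
      have h1 : 1 - x * p ^ n ≠ 0 := sub_ne_zero.2 (by exact_mod_cast (hx1 n).symm)
      have h2 : 1 - y * p ^ n ≠ 0 := sub_ne_zero.2 (by exact_mod_cast (hy1 n).symm)
      simp only [zpow_natCast]
      set X := 1 - x * p ^ n with hX
      set Y := 1 - y * p ^ n with hY
      rw [show x * p ^ n = 1 - X by rw [hX]; ring, show y * p ^ n = 1 - Y by rw [hY]; ring]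
      field_simp
      ring)
    (H2.congr_fun fun n => by
      rw [inv_one_sub_mul_zpow_neg hp0 hx hx1, inv_one_sub_mul_zpow_neg hp0 hy hy1])
  convert H using 1
  simp only [lambertOdd]
  ring

lemma hasSum_int_div_sq {x : ℝ} (hx : x ≠ 0) (hx1 : ∀ n : ℤ, x * p ^ n ≠ 1) :
    HasSum (fun n : ℤ => x * p ^ n / (1 - x * p ^ n) ^ 2)
      (lambertSq p x + lambertSq p (p / x)) := by
  refine HasSum.of_nat_of_neg_add_one (f := fun n : ℤ => x * p ^ n / (1 - x * p ^ n) ^ 2)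
    ((hasSum_lambertSq hp0 hp1 x).congr_fun fun n => by simp only [zpow_natCast])
    ((hasSum_lambertSq hp0 hp1 (p / x)).congr_fun fun n => ?_)
  have e : p ^ (-((n : ℤ) + 1)) = (p ^ (n + 1))⁻¹ := by
    rw [zpow_neg]; norm_cast
  have h1 := hx1 (-((n : ℤ) + 1))
  have e2 : p / x * p ^ n = p ^ (n + 1) / x := by rw [pow_succ]; ring
  have hr := (pow_pos hp0 (n + 1)).ne'
  rw [e] at h1
  rw [e2, e]
  set r := p ^ (n + 1)
  have h2 : r - x ≠ 0 := by
    intro h; apply h1; rw [← sub_eq_zero.1 h]; exact mul_inv_cancel₀ hr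
  have h3 : x - r ≠ 0 := by rw [← neg_sub]; exact neg_ne_zero.2 h2
  have e3 : 1 - x * r⁻¹ = (r - x) / r := by field_simp
  have e4 : 1 - r / x = (x - r) / x := by field_simp
  rw [e3, e4]
  field_simp
  ring

/-- The theta quotient with four thetas as a combination of four Lambert series. -/
theorem one_sub_mul_quot_eq {a b c L R : ℝ} (ha : a ≠ 0) (hb : b ≠ 0)
    (hc : c ≠ 0) (ha1 : ∀ n : ℤ, a * p ^ n ≠ 1) (hb1 : ∀ n : ℤ, b * p ^ n ≠ 1)
    (hab1 : ∀ n : ℤ, a * b * p ^ n ≠ 1) (hc1 : ∀ n : ℤ, c * p ^ n ≠ 1)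
    (habc1 : ∀ n : ℤ, a * b * c * p ^ n ≠ 1)
    (hL : HasProd (quotFactor p a b c) L) (hR : HasProd (resFactor p a b) R) :
    (1 - a * c) * L = R * (lambertOdd p c + lambertOdd p a + 1 - lambertOdd p (a * b * c) +
      lambertOdd p b) := by
  have ha1' : ∀ n : ℤ, a⁻¹ * p ^ n ≠ 1 := by
    intro n h
    apply ha1 (-n)
    rw [zpow_neg]
    have := (zpow_pos hp0 n).ne'
    field_simp at h ⊢
    exact h.symm
  have H := (hasSum_int_inv_sub_inv hp0 hp1 hc (inv_ne_zero ha) hc1 ha1').sub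
    (hasSum_int_inv_sub_inv hp0 hp1 (mul_ne_zero (mul_ne_zero ha hb) hc) hb habc1 hb1)
  rw [tprod_quotFactor hp0 hp1 ha hb hc ha1 hb1 hab1 hc1 habc1 hL hR, mul_left_comm,
    ← tsum_mul_left]
  have e := lambertOdd_inv hp0 hp1 ha (by simpa using ha1 0)
  rw [e] at H
  have H' := H.congr_fun (g := fun m : ℤ => (1 - a * c) * (((1 - c * p ^ m) *
    (1 - a * (p ^ m)⁻¹))⁻¹ - ((1 - a * b * c * p ^ m) * (1 - (p ^ m)⁻¹ / b))⁻¹)) (fun m => by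
      have hz := (zpow_pos hp0 m).ne'
      have h1 := sub_ne_zero.2 (hc1 m).symm
      have h2 := sub_ne_zero.2 (ha1' m).symm
      have h3 := sub_ne_zero.2 (habc1 m).symm
      have h4 := sub_ne_zero.2 (hb1 m).symm
      set z := p ^ m
      have e1 : 1 - a * z⁻¹ = -(a / z) * (1 - a⁻¹ * z) := by field_simp; ring
      have e2 : 1 - z⁻¹ / b = -(1 / (b * z)) * (1 - b * z) := by field_simp; ring
      rw [e1, e2]
      set s := 1 - a⁻¹ * z with hs
      set t := 1 - b * z with ht
      set v := 1 - a * b * c * z with hv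
      set w := 1 - c * z with hw
      have f1 : (1 - a * c) * (w * (-(a / z) * s))⁻¹ = w⁻¹ - s⁻¹ := by
        have : (1 - a * c) * z = -a * (s - w) := by
          have h5 : a * s = a - z := by rw [hs]; field_simp
          rw [hw]; linear_combination h5
        field_simp
        linear_combination -this
      have f2 : (1 - a * c) * (v * (-(1 / (b * z)) * t))⁻¹ = v⁻¹ - t⁻¹ := by
        have : (1 - a * c) * (b * z) = -(t - v) := by rw [ht, hv]; ring
        field_simp
        linear_combination this
      rw [mul_sub, f1, f2])
  rw [H'.tsum_eq]
  ring

/-- The degenerate case of the theta quotient, with double poles. -/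
theorem quot_inv_eq {b c L R : ℝ} (hb : b ≠ 0)
    (hc : c ≠ 0) (hb1 : ∀ n : ℤ, b * p ^ n ≠ 1)
    (hcb1 : ∀ n : ℤ, c⁻¹ * b * p ^ n ≠ 1) (hc1 : ∀ n : ℤ, c * p ^ n ≠ 1)
    (hL : HasProd (quotFactor p c⁻¹ b c) L) (hR : HasProd (resFactor p c⁻¹ b) R) :
    L = R * (lambertSq p b + lambertSq p (p / b) - (lambertSq p c + lambertSq p (p / c))) := by
  have hc1' : ∀ n : ℤ, c⁻¹ * p ^ n ≠ 1 := by
    intro n h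
    apply hc1 (-n)
    rw [zpow_neg]
    have := (zpow_pos hp0 n).ne'
    field_simp at h ⊢
    exact h.symm
  have e0 : c⁻¹ * b * c = b := by field_simp
  have H := (hasSum_int_div_sq hp0 hp1 hb hb1).sub (hasSum_int_div_sq hp0 hp1 hc hc1)
  rw [tprod_quotFactor hp0 hp1 (inv_ne_zero hc) hb hc hc1' hb1 hcb1 hc1 (by rwa [e0]) hL hR, e0]
  have H' := H.congr_fun (g := fun m : ℤ => ((1 - c * p ^ m) *
    (1 - c⁻¹ * (p ^ m)⁻¹))⁻¹ - ((1 - b * p ^ m) * (1 - (p ^ m)⁻¹ / b))⁻¹) (fun m => by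
      have hz := (zpow_pos hp0 m).ne'
      have h1 := sub_ne_zero.2 (hc1 m).symm
      have h2 := sub_ne_zero.2 (hb1 m).symm
      set z := p ^ m
      have e1 : 1 - c⁻¹ * z⁻¹ = -(1 / (c * z)) * (1 - c * z) := by field_simp; ring
      have e2 : 1 - z⁻¹ / b = -(1 / (b * z)) * (1 - b * z) := by field_simp; ring
      rw [e1, e2]
      set t := 1 - b * z with ht
      set w := 1 - c * z with hw
      field_simp
      ring)
  rw [H'.tsum_eq]

end

section

variable {p : ℝ} (hp0 : 0 < p) (hp1 : p < 1)

include hp0 hp1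

lemma qPoch_self_ne_zero : qPoch p p ≠ 0 := by
  refine qPoch_ne_zero hp0 hp1 fun n => ?_
  rw [← pow_succ']
  exact (pow_lt_one₀ hp0.le hp1 n.succ_ne_zero).ne

lemma hasProd_resFactor {a b : ℝ} (ha : a ≠ 0) (hb : b ≠ 0) (ha1 : ∀ n : ℤ, a * p ^ n ≠ 1)
    (hb1 : ∀ n : ℤ, b * p ^ n ≠ 1) (hab1 : ∀ n : ℤ, a * b * p ^ n ≠ 1) :
    HasProd (resFactor p a b)
      (qTheta p a * qTheta p b / (qPoch p p ^ 2 * qTheta p (a * b))) := by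
  have h := (hasProd_int_quot hp0 hp1 (mul_ne_zero ha hb) one_ne_zero ha hb (mul_one _)
    ha1 hb1).inv₀ (by
      have h1 := qTheta_ne_zero hp0 hp1 ha ha1
      have h2 := qTheta_ne_zero hp0 hp1 hb hb1
      have h3 := qTheta_ne_zero hp0 hp1 (mul_ne_zero ha hb) hab1
      have h4 := qPoch_self_ne_zero hp0 hp1
      simp [h1, h2, h3, h4])
  have e : (qTheta p (a * b) * (qPoch p (p * 1) * qPoch p (p / 1)) /
      (qTheta p a * qTheta p b))⁻¹ =
      qTheta p a * qTheta p b / (qPoch p p ^ 2 * qTheta p (a * b)) := by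
    rw [inv_div, mul_one, div_one]
    ring
  rw [e] at h
  refine h.congr_fun fun t => ?_
  rw [resFactor, inv_div, one_mul, mul_comm (ite _ _ _)]

/-- A four-theta quotient equals a combination of four Lambert series. -/
theorem qTheta_mul_eq_lambertOdd {a b c : ℝ} (ha : a ≠ 0) (hb : b ≠ 0)
    (hc : c ≠ 0) (ha1 : ∀ n : ℤ, a * p ^ n ≠ 1) (hb1 : ∀ n : ℤ, b * p ^ n ≠ 1)
    (hab1 : ∀ n : ℤ, a * b * p ^ n ≠ 1) (hc1 : ∀ n : ℤ, c * p ^ n ≠ 1)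
    (habc1 : ∀ n : ℤ, a * b * c * p ^ n ≠ 1) :
    qPoch p p ^ 2 * qTheta p (a * b) * qTheta p (b * c) * qTheta p (a * c) =
      qTheta p a * qTheta p b * qTheta p c * qTheta p (a * b * c) *
      (lambertOdd p c + lambertOdd p a + 1 - lambertOdd p (a * b * c) + lambertOdd p b) := by
  have hL : HasProd (quotFactor p a b c) _ := hasProd_int_quot hp0 hp1 (mul_ne_zero hb hc)
    (mul_ne_zero ha hc) hc (mul_ne_zero (mul_ne_zero ha hb) hc) (by ring) hc1 habc1
  have h := one_sub_mul_quot_eq hp0 hp1 ha hb hc ha1 hb1 hab1 hc1 habc1 hL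
    (hasProd_resFactor hp0 hp1 ha hb ha1 hb1 hab1)
  have e : qTheta p (a * c) = (1 - a * c) * (qPoch p (p * (a * c)) * qPoch p (p / (a * c))) := by
    rw [qTheta, qPoch_eq_mul hp0 hp1 (a * c)]
    ring
  have h1 := qTheta_ne_zero hp0 hp1 hc hc1
  have h2 := qTheta_ne_zero hp0 hp1 (mul_ne_zero (mul_ne_zero ha hb) hc) habc1
  have h3 := qTheta_ne_zero hp0 hp1 (mul_ne_zero ha hb) hab1
  have h4 := qPoch_self_ne_zero hp0 hp1
  rw [e]
  set V := lambertOdd p c + lambertOdd p a + 1 - lambertOdd p (a * b * c) + lambertOdd p b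
  clear_value V
  generalize qTheta p (a * b * c) = t₁ at h h2 ⊢
  generalize qTheta p (a * b) = t₂ at h h3 ⊢
  generalize qTheta p (b * c) = t₃ at h ⊢
  generalize qPoch p (p * (a * c)) * qPoch p (p / (a * c)) = t₄ at h ⊢
  field_simp at h
  linear_combination h

/-- A theta quotient with double poles as a combination of two bilateral Lambert series. -/
theorem qTheta_mul_eq_lambertSq {b c : ℝ} (hb : b ≠ 0)
    (hc : c ≠ 0) (hb1 : ∀ n : ℤ, b * p ^ n ≠ 1)
    (hcb1 : ∀ n : ℤ, c⁻¹ * b * p ^ n ≠ 1) (hc1 : ∀ n : ℤ, c * p ^ n ≠ 1) :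
    c * qPoch p p ^ 4 * qTheta p (b * c) * qTheta p (c⁻¹ * b) =
      (qTheta p c * qTheta p b) ^ 2 *
      (lambertSq p c + lambertSq p (p / c) - (lambertSq p b + lambertSq p (p / b))) := by
  have hc1' : ∀ n : ℤ, c⁻¹ * p ^ n ≠ 1 := by
    intro n h
    apply hc1 (-n)
    rw [zpow_neg]
    have := (zpow_pos hp0 n).ne'
    field_simp at h ⊢
    exact h.symm
  have e0 : c⁻¹ * b * c = b := by field_simp
  have hL : HasProd (quotFactor p c⁻¹ b c) _ := hasProd_int_quot hp0 hp1 (mul_ne_zero hb hc)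
    (mul_ne_zero (inv_ne_zero hc) hc) hc (w := c⁻¹ * b * c) (by rwa [e0]) (by ring) hc1
    (by rwa [e0])
  have h := quot_inv_eq hp0 hp1 hb hc hb1 hcb1 hc1 hL
    (hasProd_resFactor hp0 hp1 (inv_ne_zero hc) hb hc1' hb1 hcb1)
  rw [e0, inv_mul_cancel₀ hc, mul_one, div_one, qTheta_inv hp0 hp1 hc] at h
  have h1 := qTheta_ne_zero hp0 hp1 hc hc1
  have h2 := qTheta_ne_zero hp0 hp1 hb hb1
  have h3 := qTheta_ne_zero hp0 hp1 (mul_ne_zero (inv_ne_zero hc) hb) hcb1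
  have h4 := qPoch_self_ne_zero hp0 hp1
  generalize qTheta p (c⁻¹ * b) = t₁ at h h3 ⊢
  generalize qTheta p (b * c) = t₂ at h ⊢
  field_simp at h
  linear_combination h

end

section

variable {q : ℝ} (hq0 : 0 < q) (hq1 : q < 1)

include hq0 hq1

lemma pow_mul_zpow_ne_one {k : ℕ} (hk : ¬5 ∣ k) (n : ℤ) : q ^ k * (q ^ 5) ^ n ≠ 1 := by
  have e : q ^ k * (q ^ 5) ^ n = q ^ ((k : ℤ) + 5 * n) := by
    rw [zpow_add₀ hq0.ne', zpow_mul]; norm_cast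
  rw [e, Ne, zpow_eq_one_iff_right₀ hq0.le hq1.ne]
  lia

/-- The first Lambert series identity of level five. -/
theorem lambert_five_first :
    (1 + 3 * (lambert (q ^ 5) q - lambert (q ^ 5) (q ^ 4)) +
      (lambert (q ^ 5) (q ^ 2) - lambert (q ^ 5) (q ^ 3))) *
      (qPoch (q ^ 5) q * qPoch (q ^ 5) (q ^ 4)) ^ 3 =
    qPoch (q ^ 5) (q ^ 5) ^ 2 * (qPoch (q ^ 5) (q ^ 2) * qPoch (q ^ 5) (q ^ 3)) ^ 2 := by
  have hp0 : 0 < q ^ 5 := by positivity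
  have hp1 : q ^ 5 < 1 := pow_lt_one₀ hq0.le hq1 (by norm_num)
  have H := fun {k : ℕ} => pow_mul_zpow_ne_one hq0 hq1 (k := k)
  have hq := hq0.ne'
  have e2 : q * q = q ^ 2 := by ring
  have e3 : q * q * q = q ^ 3 := by ring
  have h1 : ∀ n : ℤ, q * (q ^ 5) ^ n ≠ 1 := by simpa using H (k := 1) (by norm_num)
  have h := qTheta_mul_eq_lambertOdd hp0 hp1 hq hq hq h1 h1 (by rw [e2]; exact H (by norm_num)) h1
    (by rw [e3]; exact H (by norm_num))
  have d1 : q ^ 5 / q = q ^ 4 := by field_simp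
  have d2 : q ^ 5 / q ^ 2 = q ^ 3 := by field_simp
  have d3 : q ^ 5 / q ^ 3 = q ^ 2 := by field_simp
  have n2 := qTheta_ne_zero hp0 hp1 (pow_ne_zero 2 hq) (H (by norm_num))
  rw [e3, e2] at h
  simp only [lambertOdd, qTheta, d1, d2, d3] at h n2
  refine mul_left_cancel₀ n2 ?_
  linear_combination -h

/-- The second Lambert series identity of level five. -/
theorem lambert_five_second :
    ((lambert (q ^ 5) q - lambert (q ^ 5) (q ^ 4)) -
      3 * (lambert (q ^ 5) (q ^ 2) - lambert (q ^ 5) (q ^ 3))) *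
      (qPoch (q ^ 5) (q ^ 2) * qPoch (q ^ 5) (q ^ 3)) ^ 3 =
    q * qPoch (q ^ 5) (q ^ 5) ^ 2 * (qPoch (q ^ 5) q * qPoch (q ^ 5) (q ^ 4)) ^ 2 := by
  have hp0 : 0 < q ^ 5 := by positivity
  have hp1 : q ^ 5 < 1 := pow_lt_one₀ hq0.le hq1 (by norm_num)
  have H := fun {k : ℕ} => pow_mul_zpow_ne_one hq0 hq1 (k := k)
  have hq := hq0.ne'
  have hq2 : q ^ 2 ≠ 0 := pow_ne_zero 2 hq
  have e2 : q ^ 2 * q ^ 2 = q ^ 4 := by ring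
  have e3 : q ^ 4 * q ^ 2 = q ^ 5 * q := by ring
  have e4 : q ^ 5 * q = q ^ 6 := by ring
  have h2 := H (k := 2) (by norm_num)
  have h := qTheta_mul_eq_lambertOdd hp0 hp1 hq2 hq2 hq2 h2 h2
    (by rw [e2]; exact H (by norm_num)) h2 (by rw [e2, e3, e4]; exact H (by norm_num))
  have d1 : q ^ 5 / q = q ^ 4 := by field_simp
  have d2 : q ^ 5 / q ^ 2 = q ^ 3 := by field_simp
  have d4 : q ^ 5 / q ^ 4 = q := by field_simp
  have n1 := qTheta_ne_zero hp0 hp1 hq (by simpa using H (k := 1) (by norm_num))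
  rw [e2, e3, qTheta_mul hp0 hp1 hq, lambertOdd_mul hp0 hp1 hq hq1.ne] at h
  simp only [lambertOdd, qTheta, d1, d2, d4] at h n1
  refine mul_left_cancel₀ n1 ?_
  field_simp at h
  linear_combination -h

/-- The Lambert series for `f(-q⁵)⁵ / f(-q)`. -/
theorem lambertSq_five :
    (lambertSq (q ^ 5) q + lambertSq (q ^ 5) (q ^ 4) -
      (lambertSq (q ^ 5) (q ^ 2) + lambertSq (q ^ 5) (q ^ 3))) *
      ((qPoch (q ^ 5) q * qPoch (q ^ 5) (q ^ 4)) *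
        (qPoch (q ^ 5) (q ^ 2) * qPoch (q ^ 5) (q ^ 3))) =
    q * qPoch (q ^ 5) (q ^ 5) ^ 4 := by
  have hp0 : 0 < q ^ 5 := by positivity
  have hp1 : q ^ 5 < 1 := pow_lt_one₀ hq0.le hq1 (by norm_num)
  have H := fun {k : ℕ} => pow_mul_zpow_ne_one hq0 hq1 (k := k)
  have hq := hq0.ne'
  have hq2 : q ^ 2 ≠ 0 := pow_ne_zero 2 hq
  have h1 : ∀ n : ℤ, q * (q ^ 5) ^ n ≠ 1 := by simpa using H (k := 1) (by norm_num)
  have h2 := H (k := 2) (by norm_num)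
  have e1 : q⁻¹ * q ^ 2 = q := by field_simp
  have e2 : q ^ 2 * q = q ^ 3 := by ring
  have d1 : q ^ 5 / q = q ^ 4 := by field_simp
  have d2 : q ^ 5 / q ^ 2 = q ^ 3 := by field_simp
  have d3 : q ^ 5 / q ^ 3 = q ^ 2 := by field_simp
  have h := qTheta_mul_eq_lambertSq hp0 hp1 hq2 hq h2 (by rwa [e1]) h1
  have n1 := qTheta_ne_zero hp0 hp1 hq h1
  have n2 := qTheta_ne_zero hp0 hp1 hq2 h2
  rw [e1, e2] at h
  simp only [qTheta, d1, d2, d3] at h n1 n2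
  refine mul_left_cancel₀ (mul_ne_zero n1 n2) ?_
  linear_combination -h

end

/-- The ratio `qⁿ / (1 - qⁿ)`, with value `0` at `n = 0`. -/
noncomputable def geomRatio (q : ℝ) (n : ℕ) : ℝ := q ^ n / (1 - q ^ n)

lemma geomRatio_zero (q : ℝ) : geomRatio q 0 = 0 := by simp [geomRatio]

lemma tsum_prod_eq_tsum_antidiagonal {F : ℕ × ℕ → ℝ} (hF : Summable F) :
    ∑' x, F x = ∑' n, ∑ x ∈ antidiagonal n, F x := by
  have h : Summable (F ∘ HasAntidiagonal.sigmaAntidiagonalEquivProd (A := ℕ)) :=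
    (Equiv.summable_iff _).2 hF
  have h2 := Summable.tsum_sigma' (fun n => (hasSum_fintype _).summable) h
  refine (((HasAntidiagonal.sigmaAntidiagonalEquivProd (A := ℕ)).tsum_eq F).symm.trans h2).trans ?_
  refine tsum_congr fun n => ?_
  rw [tsum_fintype]
  exact sum_coe_sort (antidiagonal n) F

lemma summable_sum_antidiagonal {F : ℕ × ℕ → ℝ} (hF : Summable F) :
    Summable fun n => ∑ x ∈ antidiagonal n, F x := by
  have h : Summable (F ∘ HasAntidiagonal.sigmaAntidiagonalEquivProd (A := ℕ)) :=
    (Equiv.summable_iff _).2 hF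
  refine h.sigma.congr fun n => ?_
  rw [tsum_fintype]
  exact sum_coe_sort (antidiagonal n) F

section

variable {q : ℝ} (hq0 : 0 < q) (hq1 : q < 1)

include hq0 hq1

lemma one_sub_pow_pos {n : ℕ} (hn : n ≠ 0) : 0 < 1 - q ^ n :=
  sub_pos.2 (pow_lt_one₀ hq0.le hq1 hn)

lemma geomRatio_nonneg (n : ℕ) : 0 ≤ geomRatio q n :=
  div_nonneg (pow_nonneg hq0.le n) (sub_nonneg.2 (pow_le_one₀ hq0.le hq1.le))

lemma geomRatio_le (n : ℕ) : geomRatio q n ≤ (1 - q)⁻¹ * q ^ n := by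
  have h : 0 < 1 - q := sub_pos.2 hq1
  rcases eq_or_ne n 0 with rfl | hn
  · rw [geomRatio_zero]; positivity
  · rw [geomRatio, div_eq_mul_inv, mul_comm]
    gcongr
    exact pow_le_of_le_one hq0.le hq1.le hn

lemma geomRatio_mul {a b : ℕ} (ha : a ≠ 0) (hb : b ≠ 0) :
    geomRatio q a * geomRatio q b =
      geomRatio q (a + b) * (1 + geomRatio q a + geomRatio q b) := by
  have h1 := (one_sub_pow_pos hq0 hq1 ha).ne'
  have h2 := (one_sub_pow_pos hq0 hq1 hb).ne'
  have h3 := (one_sub_pow_pos hq0 hq1 (n := a + b) (by lia)).ne'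
  simp only [geomRatio, pow_add] at *
  set x := q ^ a
  set y := q ^ b
  field_simp
  ring

lemma summable_mul_geomRatio {c : ℕ → ℝ} {K : ℝ} (hc : ∀ n, |c n| ≤ K * (n + 1)) :
    Summable fun n => c n * geomRatio q n := by
  have hs : Summable fun n : ℕ => (K * (1 - q)⁻¹) * (((n : ℝ) ^ 1 * q ^ n) + q ^ n) :=
    (((summable_pow_mul_geometric_of_norm_lt_one 1
      (by rwa [norm_of_nonneg hq0.le])).add
      (summable_geometric_of_lt_one hq0.le hq1)).mul_left _)
  refine Summable.of_norm_bounded hs fun n => ?_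
  rw [norm_mul, norm_eq_abs, norm_of_nonneg (geomRatio_nonneg hq0 hq1 n)]
  calc |c n| * geomRatio q n ≤ (K * (n + 1)) * ((1 - q)⁻¹ * q ^ n) :=
        mul_le_mul (hc n) (geomRatio_le hq0 hq1 n) (geomRatio_nonneg hq0 hq1 n)
          ((abs_nonneg _).trans (hc n))
    _ = _ := by ring

lemma summable_geomRatio : Summable (geomRatio q) := by
  have := summable_mul_geomRatio hq0 hq1 (c := fun _ => 1) (K := 1)
    (fun n => by simp)
  simpa using this

lemma summable_bounded_mul_geomRatio_mul {F : ℕ × ℕ → ℝ} {K : ℝ} (hF : ∀ x, |F x| ≤ K) :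
    Summable fun x : ℕ × ℕ => F x * (geomRatio q x.1 * geomRatio q x.2) := by
  have h := ((summable_geomRatio hq0 hq1).mul_of_nonneg (summable_geomRatio hq0 hq1)
    (geomRatio_nonneg hq0 hq1) (geomRatio_nonneg hq0 hq1)).mul_left K
  refine Summable.of_norm_bounded h fun x => ?_
  have h0 := mul_nonneg (geomRatio_nonneg hq0 hq1 x.1) (geomRatio_nonneg hq0 hq1 x.2)
  rw [norm_mul, norm_of_nonneg h0]
  exact mul_le_mul_of_nonneg_right (hF x) h0

lemma sum_antidiagonal_geomRatio (m : ℕ) :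
    ∑ x ∈ antidiagonal m, geomRatio q x.1 * geomRatio q x.2 =
      geomRatio q m * ((m - 1) + 2 * ∑ a ∈ range m, geomRatio q a) := by
  rcases m with - | m
  · simp [geomRatio_zero]
  rw [Finset.Nat.sum_antidiagonal_eq_sum_range_succ
    (fun a b => geomRatio q a * geomRatio q b), sum_range_succ, Nat.sub_self, geomRatio_zero,
    mul_zero, add_zero, sum_range_succ', geomRatio_zero, zero_mul, add_zero]
  have h : ∀ i ∈ range m, geomRatio q (i + 1) * geomRatio q (m + 1 - (i + 1)) =
      geomRatio q (m + 1) * (1 + geomRatio q (i + 1) + geomRatio q (m - 1 - i + 1)) := by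
    intro i hi
    have hi' := mem_range.1 hi
    rw [show m + 1 - (i + 1) = m - 1 - i + 1 by lia,
      geomRatio_mul hq0 hq1 (by lia) (by lia), show i + 1 + (m - 1 - i + 1) = m + 1 by lia]
  rw [sum_congr rfl h, ← mul_sum, sum_add_distrib, sum_add_distrib,
    sum_range_reflect (fun i => geomRatio q (i + 1)), sum_range_succ', geomRatio_zero]
  simp only [sum_const, card_range, nsmul_eq_mul]
  push_cast
  ring

lemma tsum_geomRatio_mul_shift (c : ℕ) :
    ∑' b, geomRatio q b * geomRatio q (b + c + 1) =
      geomRatio q (c + 1) * ∑ a ∈ range (c + 2), geomRatio q a -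
        ∑' k, geomRatio q (k + c + 2) := by
  have hs := summable_geomRatio hq0 hq1
  have hs1 := (summable_nat_add_iff 1).2 hs
  have hs2 := (summable_nat_add_iff (c + 2)).2 hs
  have hsm : Summable fun b => geomRatio q b * geomRatio q (b + c + 1) := by
    refine Summable.of_nonneg_of_le (fun b => mul_nonneg (geomRatio_nonneg hq0 hq1 _)
      (geomRatio_nonneg hq0 hq1 _)) (fun b => ?_) (hs.mul_left (1 - q)⁻¹)
    rw [mul_comm]
    refine mul_le_mul_of_nonneg_right ?_ (geomRatio_nonneg hq0 hq1 _)
    refine (geomRatio_le hq0 hq1 _).trans (mul_le_of_le_one_right ?_ ?_)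
    · exact (inv_pos.2 (sub_pos.2 hq1)).le
    · exact pow_le_one₀ hq0.le hq1.le
  rw [hsm.tsum_eq_zero_add, geomRatio_zero, zero_mul, zero_add]
  have e : ∀ b, geomRatio q (b + 1) * geomRatio q (b + 1 + c + 1) =
      geomRatio q (c + 1) * (geomRatio q (b + 1) - geomRatio q (b + (c + 2))) -
        geomRatio q (b + (c + 2)) := by
    intro b
    have h := geomRatio_mul hq0 hq1 (a := b + 1) (b := c + 1) (by lia) (by lia)
    rw [show b + 1 + (c + 1) = b + (c + 2) by ring] at h
    rw [show b + 1 + c + 1 = b + (c + 2) by ring]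
    linear_combination -h
  simp_rw [e]
  rw [((hs1.sub hs2).mul_left _).tsum_sub hs2, tsum_mul_left, hs1.tsum_sub hs2]
  have h1 := hs.sum_add_tsum_nat_add (c + 2)
  have h2 := hs.tsum_eq_zero_add
  rw [geomRatio_zero, zero_add] at h2
  have h3 : ∑ a ∈ range (c + 2), geomRatio q a =
      ∑' b, geomRatio q (b + 1) - ∑' b, geomRatio q (b + (c + 2)) := by
    rw [← h2, ← h1]; ring
  rw [h3]
  rfl

end

lemma tsum_prod_eq_diag_add_of_symm {F : ℕ × ℕ → ℝ} (hF : Summable F)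
    (hsymm : ∀ x : ℕ × ℕ, F x.swap = F x) :
    ∑' x, F x = ∑' a, F (a, a) + 2 * ∑' x : ℕ × ℕ, F (x.1, x.1 + x.2 + 1) := by
  have e : ∀ x, F x = ({x | x.1 = x.2} : Set (ℕ × ℕ)).indicator F x +
      (({x | x.1 < x.2} : Set (ℕ × ℕ)).indicator F x +
        ({x | x.2 < x.1} : Set (ℕ × ℕ)).indicator F x) := by
    rintro ⟨a, b⟩
    rcases lt_trichotomy a b with h | h | h
    · simp [Set.indicator, h, h.ne, h.not_gt]
    · simp [Set.indicator, h]
    · simp [Set.indicator, h, h.ne', h.not_gt]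
  have h1 : ∑' x, ({x | x.1 = x.2} : Set (ℕ × ℕ)).indicator F x = ∑' a, F (a, a) := by
    have hi : Function.Injective fun a : ℕ => (a, a) := fun a b h => (Prod.mk.inj h).1
    rw [← hi.tsum_eq]
    · simp
    · rintro ⟨a, b⟩ h
      have : a = b := by by_contra hne; simp [hne] at h
      exact ⟨a, by simp [this]⟩
  have h2 : ∑' x, ({x | x.1 < x.2} : Set (ℕ × ℕ)).indicator F x =
      ∑' x : ℕ × ℕ, F (x.1, x.1 + x.2 + 1) := by
    have hi : Function.Injective fun x : ℕ × ℕ => (x.1, x.1 + x.2 + 1) := by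
      rintro ⟨a, b⟩ ⟨c, d⟩ h
      simp only [Prod.mk.injEq] at h ⊢
      lia
    rw [← hi.tsum_eq]
    · refine tsum_congr fun x => ?_
      rw [Set.indicator_of_mem]
      exact (show x.1 < x.1 + x.2 + 1 by lia)
    · rintro ⟨a, b⟩ h
      have hab : a < b := by by_contra hne; simp [hne] at h
      exact ⟨(a, b - a - 1), by simp only [Prod.mk.injEq]; lia⟩
  have h3 : ∑' x, ({x | x.2 < x.1} : Set (ℕ × ℕ)).indicator F x =
      ∑' x, ({x | x.1 < x.2} : Set (ℕ × ℕ)).indicator F x := by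
    rw [← (Equiv.prodComm ℕ ℕ).tsum_eq]
    refine tsum_congr fun x => ?_
    have := hsymm x
    rcases x with ⟨a, b⟩
    by_cases h : a < b
    · simp only [Set.indicator, Equiv.prodComm_apply, Prod.swap_prod_mk]
      simpa [h] using this
    · simp [Set.indicator, h]
  rw [tsum_congr e, (hF.indicator _).tsum_add ((hF.indicator _).add (hF.indicator _)),
    (hF.indicator _).tsum_add (hF.indicator _), h1, h3, h2]
  ring

section

variable {q : ℝ} (hq0 : 0 < q) (hq1 : q < 1)

include hq0 hq1

lemma tsum_add_mul_geomRatio {f : ℕ → ℝ} {K : ℝ} (hf : ∀ n, |f n| ≤ K) :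
    Summable (fun n => (f n * ((n - 1) + 2 * ∑ a ∈ range n, geomRatio q a)) * geomRatio q n) ∧
    ∑' x : ℕ × ℕ, f (x.1 + x.2) * (geomRatio q x.1 * geomRatio q x.2) =
      ∑' n, (f n * ((n - 1) + 2 * ∑ a ∈ range n, geomRatio q a)) * geomRatio q n := by
  have hs := summable_bounded_mul_geomRatio_mul hq0 hq1 (F := fun x => f (x.1 + x.2))
    (fun x => hf _)
  have e : ∀ n, ∑ x ∈ antidiagonal n, f (x.1 + x.2) * (geomRatio q x.1 * geomRatio q x.2) =
      (f n * ((n - 1) + 2 * ∑ a ∈ range n, geomRatio q a)) * geomRatio q n := by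
    intro n
    rw [sum_congr rfl (g := fun x => f n * (geomRatio q x.1 * geomRatio q x.2))
      (fun x hx => by rw [mem_antidiagonal.1 hx]), ← mul_sum, sum_antidiagonal_geomRatio hq0 hq1]
    ring
  exact ⟨(summable_sum_antidiagonal hs).congr fun n => e n,
    (tsum_prod_eq_tsum_antidiagonal hs).trans (tsum_congr e)⟩

lemma summable_geomRatio_add_two {f : ℕ → ℝ} {K : ℝ} (hf : ∀ n, |f n| ≤ K) :
    Summable fun x : ℕ × ℕ => f (x.1 + 1) * geomRatio q (x.2 + x.1 + 2) := by
  have hg := summable_geometric_of_lt_one hq0.le hq1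
  have h := (hg.mul_of_nonneg hg (fun n => pow_nonneg hq0.le n)
    (fun n => pow_nonneg hq0.le n)).mul_left (K * (1 - q)⁻¹)
  refine Summable.of_norm_bounded h fun x => ?_
  have hi : 0 < (1 - q)⁻¹ := inv_pos.2 (sub_pos.2 hq1)
  rw [norm_mul, norm_eq_abs, norm_of_nonneg (geomRatio_nonneg hq0 hq1 _), mul_assoc]
  refine mul_le_mul (hf _) ((geomRatio_le hq0 hq1 _).trans ?_) (geomRatio_nonneg hq0 hq1 _)
    ((abs_nonneg _).trans (hf 0))
  refine mul_le_mul_of_nonneg_left ?_ hi.le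
  rw [← pow_add]
  exact pow_le_pow_of_le_one hq0.le hq1.le (by lia)

lemma tsum_tsum_geomRatio_add_two {f : ℕ → ℝ} {K : ℝ} (hf : ∀ n, |f n| ≤ K) :
    ∑' c, f (c + 1) * ∑' k, geomRatio q (k + c + 2) =
      ∑' n, (∑ c ∈ range (n - 1), f (c + 1)) * geomRatio q n := by
  have hs := summable_geomRatio_add_two hq0 hq1 hf
  have e : ∀ n, ∑ x ∈ antidiagonal n, f (x.1 + 1) * geomRatio q (x.2 + x.1 + 2) =
      (∑ c ∈ range (n + 2 - 1), f (c + 1)) * geomRatio q (n + 2) := by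
    intro n
    rw [sum_congr rfl (g := fun x => f (x.1 + 1) * geomRatio q (n + 2))
      (fun x hx => by rw [add_comm x.2, mem_antidiagonal.1 hx]), ← sum_mul,
      Finset.Nat.sum_antidiagonal_eq_sum_range_succ (fun a b => f (a + 1))]
    rfl
  have hs2 : Summable fun n => (∑ c ∈ range (n + 2 - 1), f (c + 1)) * geomRatio q (n + 2) :=
    (summable_sum_antidiagonal hs).congr fun n => e n
  have hs3 : Summable fun n => (∑ c ∈ range (n - 1), f (c + 1)) * geomRatio q n :=
    (summable_nat_add_iff 2).1 hs2
  rw [← hs3.sum_add_tsum_nat_add 2, ← tsum_congr e, ← tsum_prod_eq_tsum_antidiagonal hs,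
    hs.tsum_prod]
  simp [sum_range_succ, tsum_mul_left]

/-- Liouville's method for the convolution of the ratios `qⁿ / (1 - qⁿ)`. -/
theorem tsum_dist_sub_add_mul_geomRatio {f : ℕ → ℝ} {K : ℝ} (hf : ∀ n, |f n| ≤ K) :
    ∑' x : ℕ × ℕ, (f (x.1 - x.2 + (x.2 - x.1)) - f (x.1 + x.2)) *
      (geomRatio q x.1 * geomRatio q x.2) =
    ∑' n, (f 0 * geomRatio q n + 2 * f n * geomRatio q n - (n - 1) * f n -
      2 * ∑ c ∈ range (n - 1), f (c + 1)) * geomRatio q n := by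
  have hK : 0 ≤ K := (abs_nonneg _).trans (hf 0)
  have hB : ∀ n, geomRatio q n ≤ (1 - q)⁻¹ := fun n => (geomRatio_le hq0 hq1 n).trans
    (mul_le_of_le_one_right (inv_pos.2 (sub_pos.2 hq1)).le (pow_le_one₀ hq0.le hq1.le))
  have hs1 := summable_bounded_mul_geomRatio_mul hq0 hq1
    (F := fun x => f (x.1 - x.2 + (x.2 - x.1))) (fun x => hf _)
  have hs2 := summable_bounded_mul_geomRatio_mul hq0 hq1 (F := fun x => f (x.1 + x.2))
    (fun x => hf _)
  obtain ⟨hP, hP'⟩ := tsum_add_mul_geomRatio hq0 hq1 hf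
  have hi : Function.Injective fun x : ℕ × ℕ => (x.1, x.1 + x.2 + 1) := by
    rintro ⟨a, b⟩ ⟨c, d⟩ h
    simp only [Prod.mk.injEq] at h ⊢
    lia
  have hs3 := hs1.comp_injective hi
  have e3 : ∑' x : ℕ × ℕ, f (x.1 - (x.1 + x.2 + 1) + (x.1 + x.2 + 1 - x.1)) *
      (geomRatio q x.1 * geomRatio q (x.1 + x.2 + 1)) =
      ∑' c, f (c + 1) * (∑' b, geomRatio q b * geomRatio q (b + c + 1)) := by
    have hs4 := (Equiv.prodComm ℕ ℕ).summable_iff.2 hs3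
    rw [← (Equiv.prodComm ℕ ℕ).tsum_eq]
    refine (Summable.tsum_prod hs4).trans (tsum_congr fun c => ?_)
    rw [← tsum_mul_left]
    refine tsum_congr fun b => ?_
    simp only [Function.comp, Equiv.prodComm_apply, Prod.fst_swap, Prod.snd_swap]
    rw [show b - (b + c + 1) + (b + c + 1 - b) = c + 1 by lia]
  have hs5 : Summable fun n => (f n * ∑ a ∈ range (n + 1), geomRatio q a) * geomRatio q n := by
    refine summable_mul_geomRatio hq0 hq1 (K := K * (1 - q)⁻¹) fun n => ?_
    rw [abs_mul, mul_assoc]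
    refine mul_le_mul (hf n) ?_ (abs_nonneg _) hK
    rw [abs_of_nonneg (sum_nonneg fun i _ => geomRatio_nonneg hq0 hq1 i)]
    calc _ ≤ ∑ a ∈ range (n + 1), (1 - q)⁻¹ := sum_le_sum fun a _ => hB a
      _ = _ := by rw [sum_const, card_range, nsmul_eq_mul]; push_cast; ring
  have hs6 : Summable fun n => (∑ c ∈ range (n - 1), f (c + 1)) * geomRatio q n := by
    refine summable_mul_geomRatio hq0 hq1 (K := K) fun n => (abs_sum_le_sum_abs _ _).trans ?_
    calc _ ≤ ∑ a ∈ range (n - 1), K := sum_le_sum fun a _ => hf _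
      _ = (n - 1 : ℕ) * K := by rw [sum_const, card_range, nsmul_eq_mul]
      _ ≤ (n + 1) * K := by
        refine mul_le_mul_of_nonneg_right ?_ hK
        exact_mod_cast (show n - 1 ≤ n + 1 by lia)
      _ = _ := mul_comm _ _
  have hs7 : Summable fun n => (f 0 * geomRatio q n) * geomRatio q n := by
    refine summable_mul_geomRatio hq0 hq1 (K := K * (1 - q)⁻¹) fun n => ?_
    have h0 : 0 < (1 - q)⁻¹ := inv_pos.2 (sub_pos.2 hq1)
    rw [abs_mul, abs_of_nonneg (geomRatio_nonneg hq0 hq1 n)]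
    refine (mul_le_mul (hf 0) (hB n) (geomRatio_nonneg hq0 hq1 n) hK).trans ?_
    exact le_mul_of_one_le_right (mul_nonneg hK h0.le) (by linarith [n.cast_nonneg (α := ℝ)])
  have e4 : ∑' c, f (c + 1) * (∑' b, geomRatio q b * geomRatio q (b + c + 1)) =
      ∑' n, (f n * ∑ a ∈ range (n + 1), geomRatio q a) * geomRatio q n -
      ∑' n, (∑ c ∈ range (n - 1), f (c + 1)) * geomRatio q n := by
    rw [← tsum_tsum_geomRatio_add_two hq0 hq1 hf, hs5.tsum_eq_zero_add, geomRatio_zero, mul_zero,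
      zero_add]
    have hs8 := (summable_nat_add_iff 1).2 hs5
    have hs9 : Summable fun c => f (c + 1) * ∑' k, geomRatio q (k + c + 2) := by
      refine (summable_geomRatio_add_two hq0 hq1 hf).prod.congr fun c => ?_
      simp only [tsum_mul_left]
    rw [← hs8.tsum_sub hs9]
    refine tsum_congr fun c => ?_
    rw [tsum_geomRatio_mul_shift hq0 hq1]
    ring
  simp_rw [sub_mul]
  rw [hs1.tsum_sub hs2, hP', tsum_prod_eq_diag_add_of_symm hs1 (fun x => by
    simp only [Prod.fst_swap, Prod.snd_swap]; rw [add_comm, mul_comm (geomRatio q x.2)])]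
  simp only
  rw [e3, e4, mul_sub, ← tsum_mul_left, ← tsum_mul_left, ← (hs5.mul_left 2).tsum_sub
    (hs6.mul_left 2)]
  simp only [tsub_self, add_zero]
  rw [tsum_congr (fun a => (mul_assoc (f 0) (geomRatio q a) _).symm), ← hs7.tsum_add
    ((hs5.mul_left 2).sub (hs6.mul_left 2)), ← (hs7.add
    ((hs5.mul_left 2).sub (hs6.mul_left 2))).tsum_sub hP]
  refine tsum_congr fun n => ?_
  rw [sum_range_succ]
  ring

end

/-- The indicator function of the multiples of five. -/
noncomputable def fiveInd (n : ℕ) : ℝ := if n % 5 = 0 then 1 else 0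

/-- The odd function modulo five supported on `±1`. -/
noncomputable def fiveOddOne (n : ℕ) : ℝ := if n % 5 = 1 then 1 else if n % 5 = 4 then -1 else 0

/-- The odd function modulo five supported on `±2`. -/
noncomputable def fiveOddTwo (n : ℕ) : ℝ := if n % 5 = 2 then 1 else if n % 5 = 3 then -1 else 0

/-- The quadratic character modulo five. -/
noncomputable def fiveChar (n : ℕ) : ℝ :=
  if n % 5 = 1 ∨ n % 5 = 4 then 1 else if n % 5 = 2 ∨ n % 5 = 3 then -1 else 0

lemma abs_fiveInd_le (n : ℕ) : |fiveInd n| ≤ 1 := by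
  unfold fiveInd; split_ifs <;> simp

lemma abs_fiveOddOne_le (n : ℕ) : |fiveOddOne n| ≤ 1 := by
  unfold fiveOddOne; split_ifs <;> simp

lemma abs_fiveOddTwo_le (n : ℕ) : |fiveOddTwo n| ≤ 1 := by
  unfold fiveOddTwo; split_ifs <;> simp

lemma abs_fiveChar_le (n : ℕ) : |fiveChar n| ≤ 1 := by
  unfold fiveChar; split_ifs <;> simp

lemma fiveInd_dist_sub_add (a b : ℕ) : fiveInd (a - b + (b - a)) - fiveInd (a + b) =
    fiveOddOne a * fiveOddOne b + fiveOddTwo a * fiveOddTwo b := by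
  unfold fiveInd fiveOddOne fiveOddTwo
  split_ifs <;> first | (exfalso; lia) | norm_num

lemma fiveChar_dist_sub_add (a b : ℕ) : fiveChar (a - b + (b - a)) - fiveChar (a + b) =
    fiveOddOne a * fiveOddOne b + 2 * (fiveOddOne a * fiveOddTwo b) +
      2 * (fiveOddTwo a * fiveOddOne b) - fiveOddTwo a * fiveOddTwo b := by
  have ha : a % 5 < 5 := Nat.mod_lt _ (by norm_num)
  have hb : b % 5 < 5 := Nat.mod_lt _ (by norm_num)
  have hd : (a - b + (b - a)) % 5 = (a % 5 + 5 - b % 5) % 5 ∨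
      (a - b + (b - a)) % 5 = (b % 5 + 5 - a % 5) % 5 := by lia
  unfold fiveChar fiveOddOne fiveOddTwo
  rw [Nat.add_mod a b]
  generalize a % 5 = r at *
  generalize b % 5 = t at *
  generalize (a - b + (b - a)) % 5 = d at *
  interval_cases r <;> interval_cases t <;> rcases hd with rfl | rfl <;> norm_num

lemma sum_range_fiveInd (n : ℕ) :
    ∑ c ∈ range n, fiveInd (c + 1) = ((n : ℝ) - (n % 5 : ℕ)) / 5 := by
  induction n with
  | zero => simp
  | succ n ih =>
    rw [sum_range_succ, ih, fiveInd]
    split_ifs with h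
    · rw [h, show n % 5 = 4 by lia]
      push_cast
      ring
    · rw [show (n + 1) % 5 = n % 5 + 1 by lia]
      push_cast
      ring

lemma sum_range_fiveChar (n : ℕ) :
    ∑ c ∈ range n, fiveChar (c + 1) =
      if n % 5 = 1 then 1 else if n % 5 = 3 then -1 else 0 := by
  induction n with
  | zero => simp
  | succ n ih =>
    rw [sum_range_succ, ih, fiveChar]
    split_ifs <;> first | (exfalso; lia) | norm_num

lemma tsum_eq_sum_range_five {F : ℕ → ℝ} (hF : Summable F) :
    ∑' n, F n = ∑ i ∈ range 5, ∑' m : ℕ, F (5 * m + i) := by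
  rw [Nat.sumByResidueClasses hF 5, sum_range]
  refine sum_congr rfl fun i _ => tsum_congr fun m => ?_
  rw [add_comm]
  rfl

section

variable {q : ℝ} (hq0 : 0 < q) (hq1 : q < 1)

include hq0 hq1

lemma tsum_nat_mul_geomRatio :
    ∑' n : ℕ, (n : ℝ) * geomRatio q n = ∑' n, (1 + geomRatio q n) * geomRatio q n := by
  have hg := summable_geometric_of_lt_one hq0.le hq1
  have hg1 : Summable fun n : ℕ => ((n + 1 : ℕ) : ℝ) * q ^ n := by
    have := ((summable_pow_mul_geometric_of_norm_lt_one 1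
      (by rwa [norm_of_nonneg hq0.le] : ‖q‖ < 1)).add hg)
    refine this.congr fun n => ?_
    push_cast; ring
  have hs : Summable fun x : ℕ × ℕ => ((x.1 + 1 : ℕ) : ℝ) * q ^ ((x.1 + 1) * (x.2 + 1)) := by
    have h := hg1.mul_of_nonneg hg (fun n => by positivity) (fun n => by positivity)
    refine Summable.of_nonneg_of_le (fun x => by positivity) (fun x => ?_) h
    rw [mul_assoc, ← pow_add]
    refine mul_le_mul_of_nonneg_left (pow_le_pow_of_le_one hq0.le hq1.le ?_) (by positivity)
    nlinarith
  have hlt : ∀ n, ‖q ^ (n + 1)‖ < 1 := fun n => by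
    rw [norm_of_nonneg (by positivity)]
    exact pow_lt_one₀ hq0.le hq1 n.succ_ne_zero
  have h1 : Summable fun n : ℕ => (n : ℝ) * geomRatio q n :=
    summable_mul_geomRatio hq0 hq1 (K := 1) fun n => by
      rw [abs_of_nonneg n.cast_nonneg]; linarith
  have h2 : Summable fun n => (1 + geomRatio q n) * geomRatio q n := by
    refine summable_mul_geomRatio hq0 hq1 (K := 1 + (1 - q)⁻¹) fun n => ?_
    have h0 : 0 < (1 - q)⁻¹ := inv_pos.2 (sub_pos.2 hq1)
    have h3 := geomRatio_nonneg hq0 hq1 n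
    have h4 := (geomRatio_le hq0 hq1 n).trans
      (mul_le_of_le_one_right h0.le (pow_le_one₀ hq0.le hq1.le))
    rw [abs_of_nonneg (by positivity)]
    nlinarith [n.cast_nonneg (α := ℝ)]
  rw [h1.tsum_eq_zero_add, h2.tsum_eq_zero_add, geomRatio_zero, mul_zero, mul_zero, zero_add,
    zero_add]
  have e1 : ∀ n : ℕ, ((n + 1 : ℕ) : ℝ) * geomRatio q (n + 1) =
      ∑' k : ℕ, ((n + 1 : ℕ) : ℝ) * q ^ ((n + 1) * (k + 1)) := by
    intro n
    simp_rw [tsum_mul_left, pow_mul, pow_succ (q ^ (n + 1)), tsum_mul_right,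
      tsum_geometric_of_norm_lt_one (hlt n), geomRatio]
    ring
  have e2 : ∀ k : ℕ, (1 + geomRatio q (k + 1)) * geomRatio q (k + 1) =
      ∑' n : ℕ, ((n + 1 : ℕ) : ℝ) * q ^ ((n + 1) * (k + 1)) := by
    intro k
    have h3 := (hasSum_coe_mul_geometric_of_norm_lt_one (hlt k)).summable.tsum_eq_zero_add
    rw [tsum_coe_mul_geometric_of_norm_lt_one (hlt k)] at h3
    have h4 := (one_sub_pow_pos hq0 hq1 k.succ_ne_zero).ne'
    simp_rw [mul_comm _ (k + 1), pow_mul]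
    rw [Nat.cast_zero, zero_mul, zero_add] at h3
    rw [← h3, geomRatio]
    field_simp
    ring
  rw [tsum_congr e1, tsum_congr e2]
  exact (Summable.tsum_comm
    (f := fun n k : ℕ => ((n + 1 : ℕ) : ℝ) * q ^ ((n + 1) * (k + 1))) hs).symm

lemma summable_bounded_mul_one_add_geomRatio {c : ℕ → ℝ} (hc : ∀ n, |c n| ≤ 1) :
    Summable fun n => (c n * (1 + geomRatio q n)) * geomRatio q n := by
  refine summable_mul_geomRatio hq0 hq1 (K := 1 + (1 - q)⁻¹) fun n => ?_
  have h0 : 0 < (1 - q)⁻¹ := inv_pos.2 (sub_pos.2 hq1)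
  have h3 := geomRatio_nonneg hq0 hq1 n
  have h4 := (geomRatio_le hq0 hq1 n).trans
    (mul_le_of_le_one_right h0.le (pow_le_one₀ hq0.le hq1.le))
  rw [abs_mul, abs_of_nonneg (by positivity : 0 ≤ 1 + geomRatio q n)]
  nlinarith [n.cast_nonneg (α := ℝ), hc n, abs_nonneg (c n)]

lemma summable_bounded_mul_nat_mul_geomRatio {c : ℕ → ℝ} (hc : ∀ n, |c n| ≤ 1) :
    Summable fun n => (c n * n) * geomRatio q n :=
  summable_mul_geomRatio hq0 hq1 (K := 1) fun n => by
    rw [abs_mul, abs_of_nonneg (n.cast_nonneg : (0 : ℝ) ≤ n)]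
    nlinarith [n.cast_nonneg (α := ℝ), hc n, abs_nonneg (c n)]

lemma summable_bounded_mul_geomRatio {c : ℕ → ℝ} (hc : ∀ n, |c n| ≤ 1) :
    Summable fun n => c n * geomRatio q n :=
  summable_mul_geomRatio hq0 hq1 (K := 1) fun n =>
    (hc n).trans (by linarith [n.cast_nonneg (α := ℝ)])

omit hq0 hq1 in
lemma geomRatio_five_mul (m : ℕ) : geomRatio q (5 * m) = geomRatio (q ^ 5) m := by
  simp only [geomRatio, pow_mul]

lemma tsum_fiveInd_mul_nat_mul_geomRatio :
    ∑' n : ℕ, (fiveInd n * n) * geomRatio q n =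
      5 * ∑' n, (fiveInd n * (1 + geomRatio q n)) * geomRatio q n := by
  have hf : ∀ m i : ℕ, fiveInd (5 * m + i) = fiveInd i := fun m i => by
    simp [fiveInd]
  have h0 : fiveInd 0 = 1 := by simp [fiveInd]
  have h1 : fiveInd 1 = 0 := by simp [fiveInd]
  have h2 : fiveInd 2 = 0 := by simp [fiveInd]
  have h3 : fiveInd 3 = 0 := by simp [fiveInd]
  have h4 : fiveInd 4 = 0 := by simp [fiveInd]
  rw [tsum_eq_sum_range_five (summable_bounded_mul_one_add_geomRatio hq0 hq1 abs_fiveInd_le),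
    tsum_eq_sum_range_five (summable_bounded_mul_nat_mul_geomRatio hq0 hq1 abs_fiveInd_le)]
  simp only [sum_range_succ, range_zero, sum_empty, hf, h0, h1, h2, h3, h4, zero_mul, one_mul,
    tsum_zero, add_zero, zero_add, geomRatio_five_mul]
  rw [← tsum_nat_mul_geomRatio (by positivity) (pow_lt_one₀ hq0.le hq1 (by norm_num)),
    ← tsum_mul_left]
  refine tsum_congr fun m => ?_
  push_cast
  ring

lemma tsum_mul_tsum_geomRatio {c d : ℕ → ℝ} (hc : ∀ n, |c n| ≤ 1) (hd : ∀ n, |d n| ≤ 1) :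
    Summable (fun x : ℕ × ℕ => (c x.1 * d x.2) * (geomRatio q x.1 * geomRatio q x.2)) ∧
    (∑' n, c n * geomRatio q n) * (∑' n, d n * geomRatio q n) =
      ∑' x : ℕ × ℕ, (c x.1 * d x.2) * (geomRatio q x.1 * geomRatio q x.2) := by
  have hs := summable_bounded_mul_geomRatio_mul hq0 hq1 (F := fun x => c x.1 * d x.2) (K := 1)
    (fun x => by
      rw [abs_mul]
      exact mul_le_one₀ (hc _) (abs_nonneg _) (hd _))
  have e : ∀ x : ℕ × ℕ, (c x.1 * d x.2) * (geomRatio q x.1 * geomRatio q x.2) =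
      (c x.1 * geomRatio q x.1) * (d x.2 * geomRatio q x.2) := fun x => by ring
  refine ⟨hs, ?_⟩
  rw [tsum_congr e]
  exact (summable_bounded_mul_geomRatio hq0 hq1 hc).tsum_mul_tsum
    (summable_bounded_mul_geomRatio hq0 hq1 hd) (hs.congr e)

/-- The sum of the squares of the two odd Lambert series modulo five. -/
theorem tsum_fiveOdd_sq_add_sq :
    (∑' n, fiveOddOne n * geomRatio q n) ^ 2 + (∑' n, fiveOddTwo n * geomRatio q n) ^ 2 =
      3 / 5 * (∑' n : ℕ, ((1 - fiveInd n) * n) * geomRatio q n) -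
      3 / 5 * (∑' n, fiveOddOne n * geomRatio q n) -
      1 / 5 * (∑' n, fiveOddTwo n * geomRatio q n) := by
  obtain ⟨t1, t2⟩ := tsum_mul_tsum_geomRatio hq0 hq1 abs_fiveOddOne_le abs_fiveOddOne_le
  obtain ⟨t3, t4⟩ := tsum_mul_tsum_geomRatio hq0 hq1 abs_fiveOddTwo_le abs_fiveOddTwo_le
  have h := tsum_dist_sub_add_mul_geomRatio hq0 hq1 abs_fiveInd_le
  simp_rw [fiveInd_dist_sub_add, add_mul] at h
  rw [t1.tsum_add t3, ← t2, ← t4] at h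
  rw [sq, sq, h]
  have u1 := summable_bounded_mul_one_add_geomRatio hq0 hq1 (c := fun _ => 1) (by simp)
  have u2 := summable_bounded_mul_one_add_geomRatio hq0 hq1 abs_fiveInd_le
  have u3 := summable_bounded_mul_nat_mul_geomRatio hq0 hq1 (c := fun _ => 1) (by simp)
  have u4 := summable_bounded_mul_nat_mul_geomRatio hq0 hq1 abs_fiveInd_le
  have u5 := summable_bounded_mul_geomRatio hq0 hq1 abs_fiveOddOne_le
  have u6 := summable_bounded_mul_geomRatio hq0 hq1 abs_fiveOddTwo_le
  have v1 := tsum_nat_mul_geomRatio hq0 hq1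
  have v2 := tsum_fiveInd_mul_nat_mul_geomRatio hq0 hq1
  simp only [one_mul] at u1 u3
  have e1 : ∑' n : ℕ, ((1 - fiveInd n) * n) * geomRatio q n =
      ∑' n : ℕ, (n : ℝ) * geomRatio q n - ∑' n : ℕ, (fiveInd n * n) * geomRatio q n := by
    rw [← u3.tsum_sub u4]
    exact tsum_congr fun n => by ring
  have e2 : ∀ n : ℕ, (fiveInd 0 * geomRatio q n + 2 * fiveInd n * geomRatio q n -
      (n - 1) * fiveInd n - 2 * ∑ c ∈ range (n - 1), fiveInd (c + 1)) * geomRatio q n =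
      ((1 + geomRatio q n) * geomRatio q n + 2 * ((fiveInd n * (1 + geomRatio q n)) *
        geomRatio q n)) - (2 / 5 * ((n : ℝ) * geomRatio q n) +
        ((fiveInd n * n) * geomRatio q n + (3 / 5 * (fiveOddOne n * geomRatio q n) +
        1 / 5 * (fiveOddTwo n * geomRatio q n)))) := by
    intro n
    rcases n with - | n
    · simp [geomRatio_zero]
    rw [Nat.add_sub_cancel, sum_range_fiveInd, show fiveInd 0 = 1 by simp [fiveInd]]
    have hn : n % 5 < 5 := Nat.mod_lt _ (by norm_num)
    have hm : (n + 1) % 5 = (n % 5 + 1) % 5 := by lia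
    unfold fiveInd fiveOddOne fiveOddTwo
    rw [hm]
    generalize geomRatio q (n + 1) = g
    generalize n % 5 = r at *
    push_cast
    interval_cases r <;> norm_num <;> ring
  rw [tsum_congr e2, (u1.add (u2.mul_left 2)).tsum_sub ((u3.mul_left _).add (u4.add
    ((u5.mul_left _).add (u6.mul_left _)))), u1.tsum_add (u2.mul_left 2),
    (u3.mul_left _).tsum_add (u4.add ((u5.mul_left _).add (u6.mul_left _))),
    u4.tsum_add ((u5.mul_left _).add (u6.mul_left _)),
    (u5.mul_left _).tsum_add (u6.mul_left _), e1]
  simp only [tsum_mul_left]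
  rw [← v1]
  linear_combination -(2 / 5) * v2

/-- The second quadratic relation between the odd Lambert series modulo five. -/
theorem tsum_fiveOdd_sq_sub_sq :
    (∑' n, fiveOddOne n * geomRatio q n) ^ 2 +
      4 * (∑' n, fiveOddOne n * geomRatio q n) * (∑' n, fiveOddTwo n * geomRatio q n) -
      (∑' n, fiveOddTwo n * geomRatio q n) ^ 2 =
      2 * (∑' n, (fiveChar n * (1 + geomRatio q n)) * geomRatio q n) -
      (∑' n : ℕ, (fiveChar n * n) * geomRatio q n) -
      (∑' n, fiveOddOne n * geomRatio q n) - (∑' n, fiveOddTwo n * geomRatio q n) := by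
  obtain ⟨t1, t2⟩ := tsum_mul_tsum_geomRatio hq0 hq1 abs_fiveOddOne_le abs_fiveOddOne_le
  obtain ⟨t3, t4⟩ := tsum_mul_tsum_geomRatio hq0 hq1 abs_fiveOddTwo_le abs_fiveOddTwo_le
  obtain ⟨t5, t6⟩ := tsum_mul_tsum_geomRatio hq0 hq1 abs_fiveOddOne_le abs_fiveOddTwo_le
  obtain ⟨t7, t8⟩ := tsum_mul_tsum_geomRatio hq0 hq1 abs_fiveOddTwo_le abs_fiveOddOne_le
  have h := tsum_dist_sub_add_mul_geomRatio hq0 hq1 abs_fiveChar_le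
  have e1 : ∀ x : ℕ × ℕ, (fiveChar (x.1 - x.2 + (x.2 - x.1)) - fiveChar (x.1 + x.2)) *
      (geomRatio q x.1 * geomRatio q x.2) =
      fiveOddOne x.1 * fiveOddOne x.2 * (geomRatio q x.1 * geomRatio q x.2) +
        2 * (fiveOddOne x.1 * fiveOddTwo x.2 * (geomRatio q x.1 * geomRatio q x.2)) +
        2 * (fiveOddTwo x.1 * fiveOddOne x.2 * (geomRatio q x.1 * geomRatio q x.2)) -
        fiveOddTwo x.1 * fiveOddTwo x.2 * (geomRatio q x.1 * geomRatio q x.2) := fun x => by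
    rw [fiveChar_dist_sub_add]; ring
  rw [tsum_congr e1, ((t1.add (t5.mul_left 2)).add (t7.mul_left 2)).tsum_sub t3,
    (t1.add (t5.mul_left 2)).tsum_add (t7.mul_left 2), t1.tsum_add (t5.mul_left 2),
    tsum_mul_left, tsum_mul_left, ← t2, ← t4, ← t6, ← t8] at h
  have u2 := summable_bounded_mul_one_add_geomRatio hq0 hq1 abs_fiveChar_le
  have u4 := summable_bounded_mul_nat_mul_geomRatio hq0 hq1 abs_fiveChar_le
  have u5 := summable_bounded_mul_geomRatio hq0 hq1 abs_fiveOddOne_le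
  have u6 := summable_bounded_mul_geomRatio hq0 hq1 abs_fiveOddTwo_le
  have e2 : ∀ n : ℕ, (fiveChar 0 * geomRatio q n + 2 * fiveChar n * geomRatio q n -
      (n - 1) * fiveChar n - 2 * ∑ c ∈ range (n - 1), fiveChar (c + 1)) * geomRatio q n =
      2 * ((fiveChar n * (1 + geomRatio q n)) * geomRatio q n) -
        ((fiveChar n * n) * geomRatio q n + (fiveOddOne n * geomRatio q n +
        fiveOddTwo n * geomRatio q n)) := by
    intro n
    rcases n with - | n
    · simp [geomRatio_zero]
    rw [Nat.add_sub_cancel, sum_range_fiveChar, show fiveChar 0 = 0 by simp [fiveChar]]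
    have hn : n % 5 < 5 := Nat.mod_lt _ (by norm_num)
    have hm : (n + 1) % 5 = (n % 5 + 1) % 5 := by lia
    unfold fiveChar fiveOddOne fiveOddTwo
    rw [hm]
    generalize geomRatio q (n + 1) = g
    generalize n % 5 = r at *
    push_cast
    interval_cases r <;> norm_num <;> ring
  rw [tsum_congr e2, (u2.mul_left 2).tsum_sub (u4.add (u5.add u6)), u4.tsum_add (u5.add u6),
    u5.tsum_add u6, tsum_mul_left] at h
  linear_combination h

end

/-- The product `∏ (1 - q^(5 n + i))` over `n ≥ 0`. -/
noncomputable def fivePoch (i : ℕ) (q : ℝ) : ℝ := qPoch (q ^ 5) (q ^ i)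

/-- The Lambert series `∑ k q^k / (1 - q^k)` over `k = 5 n + i`, `n ≥ 0`. -/
noncomputable def fiveWeighted (i : ℕ) (q : ℝ) : ℝ :=
  ∑' n : ℕ, ((5 * n + i : ℕ) : ℝ) * geomRatio q (5 * n + i)

section

variable {q : ℝ} (hq0 : 0 < q) (hq1 : q < 1)

lemma geomRatio_five_mul_add (m i : ℕ) :
    geomRatio q (5 * m + i) = q ^ i * (q ^ 5) ^ m / (1 - q ^ i * (q ^ 5) ^ m) := by
  rw [geomRatio, pow_add, pow_mul, mul_comm]

include hq0 hq1

lemma tsum_fiveOddOne_mul_geomRatio :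
    ∑' n, fiveOddOne n * geomRatio q n = lambert (q ^ 5) q - lambert (q ^ 5) (q ^ 4) := by
  have hf : ∀ m i : ℕ, fiveOddOne (5 * m + i) = fiveOddOne i := fun m i => by
    simp [fiveOddOne]
  have h0 : fiveOddOne 0 = 0 := by simp [fiveOddOne]
  have h1 : fiveOddOne 1 = 1 := by simp [fiveOddOne]
  have h2 : fiveOddOne 2 = 0 := by simp [fiveOddOne]
  have h3 : fiveOddOne 3 = 0 := by simp [fiveOddOne]
  have h4 : fiveOddOne 4 = -1 := by simp [fiveOddOne]
  rw [tsum_eq_sum_range_five (summable_bounded_mul_geomRatio hq0 hq1 abs_fiveOddOne_le)]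
  simp only [sum_range_succ, range_zero, sum_empty, hf, h0, h1, h2, h3, h4, zero_mul, one_mul,
    tsum_zero, add_zero, zero_add, geomRatio_five_mul_add, neg_one_mul, tsum_neg, lambert, pow_one]
  ring

lemma tsum_fiveOddTwo_mul_geomRatio :
    ∑' n, fiveOddTwo n * geomRatio q n =
      lambert (q ^ 5) (q ^ 2) - lambert (q ^ 5) (q ^ 3) := by
  have hf : ∀ m i : ℕ, fiveOddTwo (5 * m + i) = fiveOddTwo i := fun m i => by
    simp [fiveOddTwo]
  have h0 : fiveOddTwo 0 = 0 := by simp [fiveOddTwo]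
  have h1 : fiveOddTwo 1 = 0 := by simp [fiveOddTwo]
  have h2 : fiveOddTwo 2 = 1 := by simp [fiveOddTwo]
  have h3 : fiveOddTwo 3 = -1 := by simp [fiveOddTwo]
  have h4 : fiveOddTwo 4 = 0 := by simp [fiveOddTwo]
  rw [tsum_eq_sum_range_five (summable_bounded_mul_geomRatio hq0 hq1 abs_fiveOddTwo_le)]
  simp only [sum_range_succ, range_zero, sum_empty, hf, h0, h1, h2, h3, h4, zero_mul, one_mul,
    tsum_zero, add_zero, zero_add, geomRatio_five_mul_add, neg_one_mul, tsum_neg, lambert]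
  ring

lemma tsum_fiveChar_mul_one_add_geomRatio :
    ∑' n, (fiveChar n * (1 + geomRatio q n)) * geomRatio q n =
      lambertSq (q ^ 5) q + lambertSq (q ^ 5) (q ^ 4) -
        (lambertSq (q ^ 5) (q ^ 2) + lambertSq (q ^ 5) (q ^ 3)) := by
  have hf : ∀ m i : ℕ, fiveChar (5 * m + i) = fiveChar i := fun m i => by
    simp [fiveChar]
  have h0 : fiveChar 0 = 0 := by simp [fiveChar]
  have h1 : fiveChar 1 = 1 := by simp [fiveChar]
  have h2 : fiveChar 2 = -1 := by simp [fiveChar]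
  have h3 : fiveChar 3 = -1 := by simp [fiveChar]
  have h4 : fiveChar 4 = 1 := by simp [fiveChar]
  have e : ∀ i : ℕ, i ≠ 0 → ∀ m : ℕ, (1 + geomRatio q (5 * m + i)) * geomRatio q (5 * m + i) =
      q ^ i * (q ^ 5) ^ m / (1 - q ^ i * (q ^ 5) ^ m) ^ 2 := by
    intro i hi m
    have h := (one_sub_pow_pos hq0 hq1 (n := 5 * m + i) (by lia)).ne'
    rw [pow_add, pow_mul, mul_comm] at h
    rw [geomRatio_five_mul_add]
    field_simp
    ring
  rw [tsum_eq_sum_range_five (summable_bounded_mul_one_add_geomRatio hq0 hq1 abs_fiveChar_le)]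
  simp only [sum_range_succ, range_zero, sum_empty, hf, h0, h1, h2, h3, h4, zero_mul, one_mul,
    tsum_zero, zero_add, neg_mul, tsum_neg, e 1 one_ne_zero, e 2 two_ne_zero, e 3 three_ne_zero,
    e 4 four_ne_zero, lambertSq, pow_one]
  ring

lemma tsum_one_sub_fiveInd_mul_nat_mul_geomRatio :
    ∑' n : ℕ, ((1 - fiveInd n) * n) * geomRatio q n =
      fiveWeighted 1 q + fiveWeighted 2 q + fiveWeighted 3 q + fiveWeighted 4 q := by
  have hc : ∀ n, |1 - fiveInd n| ≤ 1 := fun n => by unfold fiveInd; split_ifs <;> simp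
  have hf : ∀ m i : ℕ, fiveInd (5 * m + i) = fiveInd i := fun m i => by
    simp [fiveInd]
  have h0 : fiveInd 0 = 1 := by simp [fiveInd]
  have h1 : fiveInd 1 = 0 := by simp [fiveInd]
  have h2 : fiveInd 2 = 0 := by simp [fiveInd]
  have h3 : fiveInd 3 = 0 := by simp [fiveInd]
  have h4 : fiveInd 4 = 0 := by simp [fiveInd]
  rw [tsum_eq_sum_range_five (summable_bounded_mul_nat_mul_geomRatio hq0 hq1 hc)]
  simp only [sum_range_succ, range_zero, sum_empty, hf, h0, h1, h2, h3, h4, sub_self, sub_zero,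
    zero_mul, one_mul, tsum_zero, zero_add, fiveWeighted]

lemma tsum_fiveChar_mul_nat_mul_geomRatio :
    ∑' n : ℕ, (fiveChar n * n) * geomRatio q n =
      fiveWeighted 1 q - fiveWeighted 2 q - fiveWeighted 3 q + fiveWeighted 4 q := by
  have hf : ∀ m i : ℕ, fiveChar (5 * m + i) = fiveChar i := fun m i => by
    simp [fiveChar]
  have h0 : fiveChar 0 = 0 := by simp [fiveChar]
  have h1 : fiveChar 1 = 1 := by simp [fiveChar]
  have h2 : fiveChar 2 = -1 := by simp [fiveChar]
  have h3 : fiveChar 3 = -1 := by simp [fiveChar]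
  have h4 : fiveChar 4 = 1 := by simp [fiveChar]
  rw [tsum_eq_sum_range_five (summable_bounded_mul_nat_mul_geomRatio hq0 hq1 abs_fiveChar_le)]
  simp only [sum_range_succ, range_zero, sum_empty, hf, h0, h1, h2, h3, h4, neg_mul, tsum_neg,
    zero_mul, one_mul, tsum_zero, zero_add, fiveWeighted]
  ring

lemma fivePoch_pos {i : ℕ} (hi : i ≠ 0) : 0 < fivePoch i q := by
  have hp0 : 0 < q ^ 5 := by positivity
  have hp1 : q ^ 5 < 1 := pow_lt_one₀ hq0.le hq1 (by norm_num)
  have hpos : ∀ n : ℕ, 0 < 1 - q ^ i * (q ^ 5) ^ n := fun n => by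
    have h := one_sub_pow_pos hq0 hq1 (n := 5 * n + i) (by lia)
    rwa [pow_add, pow_mul, mul_comm] at h
  refine lt_of_le_of_ne ?_ (qPoch_ne_zero hp0 hp1 fun n h => ?_).symm
  · exact ge_of_tendsto (hasProd_qPoch hp0 hp1 (q ^ i)).tendsto_prod_nat
      (Eventually.of_forall fun N => prod_nonneg fun n _ => (hpos n).le)
  · linarith [hpos n]

/-- The quotients `X` and `Y` of theta products satisfy `X² + Y² = 1 + 6 ∑ k q^k / (1 - q^k)`,
the sum being over the `k` coprime to five. -/
theorem fivePoch_sq_add_sq :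
    (fivePoch 5 q ^ 2 * (fivePoch 2 q * fivePoch 3 q) ^ 2 /
        (fivePoch 1 q * fivePoch 4 q) ^ 3) ^ 2 +
      (q * fivePoch 5 q ^ 2 * (fivePoch 1 q * fivePoch 4 q) ^ 2 /
        (fivePoch 2 q * fivePoch 3 q) ^ 3) ^ 2 =
      1 + 6 * (fiveWeighted 1 q + fiveWeighted 2 q + fiveWeighted 3 q + fiveWeighted 4 q) := by
  have h1 := fivePoch_pos hq0 hq1 (i := 1) (by norm_num)
  have h2 := fivePoch_pos hq0 hq1 (i := 2) (by norm_num)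
  have h3 := fivePoch_pos hq0 hq1 (i := 3) (by norm_num)
  have h4 := fivePoch_pos hq0 hq1 (i := 4) (by norm_num)
  have hX := lambert_five_first hq0 hq1
  have hY := lambert_five_second hq0 hq1
  have h := tsum_fiveOdd_sq_add_sq hq0 hq1
  rw [tsum_fiveOddOne_mul_geomRatio hq0 hq1, tsum_fiveOddTwo_mul_geomRatio hq0 hq1,
    tsum_one_sub_fiveInd_mul_nat_mul_geomRatio hq0 hq1] at h
  rw [show qPoch (q ^ 5) q = fivePoch 1 q by simp [fivePoch]] at hX hY
  rw [show qPoch (q ^ 5) (q ^ 5) = fivePoch 5 q from rfl,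
    show qPoch (q ^ 5) (q ^ 2) = fivePoch 2 q from rfl,
    show qPoch (q ^ 5) (q ^ 3) = fivePoch 3 q from rfl,
    show qPoch (q ^ 5) (q ^ 4) = fivePoch 4 q from rfl] at hX hY
  rw [← hX, ← hY, mul_div_cancel_right₀ _ (by positivity), mul_div_cancel_right₀ _ (by positivity)]
  linear_combination 10 * h

/-- The quotients `X` and `Y` of theta products satisfy
`X² - 11 X Y - Y² = 1 - 5 ∑ (k / 5) k q^k / (1 - q^k)`. -/
theorem fivePoch_sq_sub_sq :
    (fivePoch 5 q ^ 2 * (fivePoch 2 q * fivePoch 3 q) ^ 2 /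
        (fivePoch 1 q * fivePoch 4 q) ^ 3) ^ 2 -
      (q * fivePoch 5 q ^ 2 * (fivePoch 1 q * fivePoch 4 q) ^ 2 /
        (fivePoch 2 q * fivePoch 3 q) ^ 3) ^ 2 -
      11 * (q * fivePoch 5 q ^ 4 / ((fivePoch 1 q * fivePoch 4 q) *
        (fivePoch 2 q * fivePoch 3 q))) =
      1 - 5 * (fiveWeighted 1 q - fiveWeighted 2 q - fiveWeighted 3 q + fiveWeighted 4 q) := by
  have h1 := fivePoch_pos hq0 hq1 (i := 1) (by norm_num)
  have h2 := fivePoch_pos hq0 hq1 (i := 2) (by norm_num)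
  have h3 := fivePoch_pos hq0 hq1 (i := 3) (by norm_num)
  have h4 := fivePoch_pos hq0 hq1 (i := 4) (by norm_num)
  have hX := lambert_five_first hq0 hq1
  have hY := lambert_five_second hq0 hq1
  have hB := lambertSq_five hq0 hq1
  have h := tsum_fiveOdd_sq_sub_sq hq0 hq1
  rw [tsum_fiveOddOne_mul_geomRatio hq0 hq1, tsum_fiveOddTwo_mul_geomRatio hq0 hq1,
    tsum_fiveChar_mul_one_add_geomRatio hq0 hq1, tsum_fiveChar_mul_nat_mul_geomRatio hq0 hq1] at h
  rw [show qPoch (q ^ 5) q = fivePoch 1 q by simp [fivePoch]] at hX hY hB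
  rw [show qPoch (q ^ 5) (q ^ 5) = fivePoch 5 q from rfl,
    show qPoch (q ^ 5) (q ^ 2) = fivePoch 2 q from rfl,
    show qPoch (q ^ 5) (q ^ 3) = fivePoch 3 q from rfl,
    show qPoch (q ^ 5) (q ^ 4) = fivePoch 4 q from rfl] at hX hY hB
  have hXY : (q * fivePoch 5 q ^ 4 / ((fivePoch 1 q * fivePoch 4 q) *
        (fivePoch 2 q * fivePoch 3 q))) = (fivePoch 5 q ^ 2 * (fivePoch 2 q * fivePoch 3 q) ^ 2 /
        (fivePoch 1 q * fivePoch 4 q) ^ 3) * (q * fivePoch 5 q ^ 2 *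
        (fivePoch 1 q * fivePoch 4 q) ^ 2 / (fivePoch 2 q * fivePoch 3 q) ^ 3) := by
    field_simp
  have hXY' := hXY
  nth_rw 1 [← hB] at hXY'
  rw [← hX, ← hY, mul_div_cancel_right₀ _ (by positivity), mul_div_cancel_right₀ _ (by positivity),
    mul_div_cancel_right₀ _ (by positivity)] at hXY'
  rw [hXY, ← hX, ← hY, mul_div_cancel_right₀ _ (by positivity),
    mul_div_cancel_right₀ _ (by positivity)]
  linear_combination 5 * h + 10 * hXY'

end

section

lemma one_sub_pow_pos_of_abs_lt {q : ℝ} (hq : |q| < 1) {n : ℕ} (hn : n ≠ 0) : 0 < 1 - q ^ n := by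
  have h : |q ^ n| < 1 := by
    rw [abs_pow]
    exact pow_lt_one₀ (abs_nonneg q) hq hn
  linarith [le_abs_self (q ^ n)]

lemma summable_log_one_sub_pow {q : ℝ} (hq : |q| < 1) {e : ℕ → ℕ} (he : Function.Injective e) :
    Summable fun n => log (1 - q ^ e n) := by
  have h := Real.summable_log_one_add_of_summable
    ((summable_geometric_of_abs_lt_one hq).comp_injective he).neg
  exact h.congr fun n => by simp [sub_eq_add_neg]

lemma injective_five_mul_add (i : ℕ) : Function.Injective fun n : ℕ => 5 * n + i :=
  fun a b h => by simpa using h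

lemma fivePoch_eq_exp {q : ℝ} (hq : |q| < 1) {i : ℕ} (hi : i ≠ 0) :
    fivePoch i q = exp (∑' n : ℕ, log (1 - q ^ (5 * n + i))) := by
  rw [Real.rexp_tsum_eq_tprod (fun n => one_sub_pow_pos_of_abs_lt hq (by lia))
    (summable_log_one_sub_pow hq (injective_five_mul_add i)), fivePoch, qPoch]
  exact tprod_congr fun n => by rw [pow_add, pow_mul, mul_comm]

lemma fivePoch_zero {i : ℕ} (hi : i ≠ 0) : fivePoch i 0 = 1 := by
  simp [fivePoch, qPoch, hi]

lemma eulerF_eq_prod_fivePoch {q : ℝ} (hq : |q| < 1) :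
    eulerF q = fivePoch 1 q * fivePoch 2 q * fivePoch 3 q * fivePoch 4 q * fivePoch 5 q := by
  have hs := summable_log_one_sub_pow hq (add_left_injective 1)
  rw [eulerF, ← Real.rexp_tsum_eq_tprod (fun n => one_sub_pow_pos_of_abs_lt hq n.succ_ne_zero) hs,
    tsum_eq_sum_range_five hs, exp_sum]
  simp only [prod_range_succ, range_zero, prod_empty, one_mul, add_assoc, Nat.reduceAdd, zero_add,
    fivePoch_eq_exp hq one_ne_zero, fivePoch_eq_exp hq two_ne_zero,
    fivePoch_eq_exp hq three_ne_zero, fivePoch_eq_exp hq four_ne_zero,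
    fivePoch_eq_exp hq (by norm_num : 5 ≠ 0)]

lemma eulerF_pow_five (q : ℝ) : eulerF (q ^ 5) = fivePoch 5 q :=
  tprod_congr fun n => by rw [pow_succ, mul_comm]

lemma hasDerivAt_fivePoch_of_abs_lt {q : ℝ} (hq : |q| < 1) {i : ℕ} (hi : i ≠ 0) :
    HasDerivAt (fivePoch i) (fivePoch i q * ∑' n : ℕ,
      -(((5 * n + i : ℕ) : ℝ) * q ^ (5 * n + i - 1)) / (1 - q ^ (5 * n + i))) q := by
  obtain ⟨r, hqr, hr1⟩ := exists_between hq
  have hr0 : 0 ≤ r := (abs_nonneg q).trans hqr.le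
  have hmem : q ∈ Set.Ioo (-r) r := abs_lt.1 hqr
  have hlt : ∀ y ∈ Set.Ioo (-r) r, |y| < 1 := fun y hy => (abs_lt.2 hy).trans hr1
  have hb : Summable fun k : ℕ => ((k : ℝ) * r ^ (k - 1)) * (1 - r)⁻¹ := by
    refine Summable.mul_right _ ((summable_nat_add_iff 1).1 ?_)
    have h := (summable_pow_mul_geometric_of_norm_lt_one 1
      (by rwa [norm_of_nonneg hr0] : ‖r‖ < 1)).add (summable_geometric_of_lt_one hr0 hr1)
    refine h.congr fun n => ?_
    push_cast
    ring
  have h := hasDerivAt_tsum_of_isPreconnected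
    (g := fun (n : ℕ) (y : ℝ) => log (1 - y ^ (5 * n + i)))
    (g' := fun (n : ℕ) (y : ℝ) =>
      -(((5 * n + i : ℕ) : ℝ) * y ^ (5 * n + i - 1)) / (1 - y ^ (5 * n + i)))
    (hb.comp_injective (injective_five_mul_add i)) isOpen_Ioo isPreconnected_Ioo
    (fun n y hy => ((hasDerivAt_pow (5 * n + i) y).const_sub 1).log
      (one_sub_pow_pos_of_abs_lt (hlt y hy) (by lia)).ne')
    (fun n y hy => ?_) hmem (summable_log_one_sub_pow hq (injective_five_mul_add i)) hmem
  · rw [fivePoch_eq_exp hq hi]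
    refine h.exp.congr_of_eventuallyEq ?_
    filter_upwards [isOpen_Ioo.mem_nhds hmem] with y hy using fivePoch_eq_exp (hlt y hy) hi
  · have hy' : |y| ≤ r := (abs_lt.2 hy).le
    have hk : 5 * n + i ≠ 0 := by lia
    have h1 : 1 - r ≤ 1 - y ^ (5 * n + i) := by
      have h2 : |y ^ (5 * n + i)| ≤ r := by
        rw [abs_pow]
        exact (pow_le_of_le_one (abs_nonneg y) (hlt y hy).le hk).trans hy'
      linarith [le_abs_self (y ^ (5 * n + i))]
    have h3 : 0 < 1 - r := sub_pos.2 hr1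
    simp only [Function.comp_apply]
    rw [norm_div, norm_neg, norm_mul, norm_pow, norm_eq_abs y, RCLike.norm_natCast,
      norm_of_nonneg (h3.le.trans h1), div_eq_mul_inv]
    have h4 := inv_nonneg.2 (h3.le.trans h1)
    gcongr

lemma hasDerivAt_fivePoch {q : ℝ} (hq0 : 0 < q) (hq1 : q < 1) {i : ℕ} (hi : i ≠ 0) :
    HasDerivAt (fivePoch i) (-(fivePoch i q * fiveWeighted i q) / q) q := by
  refine (hasDerivAt_fivePoch_of_abs_lt (by rwa [abs_of_pos hq0]) hi).congr_deriv ?_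
  rw [neg_div, mul_div_assoc, ← mul_neg, fiveWeighted, ← tsum_div_const, ← tsum_neg]
  congr 1
  refine tsum_congr fun n => ?_
  have h : q ^ (5 * n + i) = q ^ (5 * n + i - 1) * q := by
    rw [← pow_succ]; congr 1; lia
  rw [geomRatio, neg_div, mul_div_assoc, mul_div_assoc]
  nth_rw 3 [h]
  congr 2
  field_simp
  rw [← h]

lemma uF_eq_div {q : ℝ} (hq0 : 0 < q) (hq1 : q < 1) :
    uF q = ((fivePoch 1 q * fivePoch 4 q) * (fivePoch 2 q * fivePoch 3 q)) ^ 6 / q := by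
  have h := fivePoch_pos hq0 hq1 (i := 5) (by norm_num)
  rw [uF, eulerF_pow_five, eulerF_eq_prod_fivePoch (by rwa [abs_of_pos hq0])]
  field_simp

/-- The derivative of the product of two of the series `fivePoch`. -/
lemma hasDerivAt_fivePoch_mul {q : ℝ} (hq0 : 0 < q) (hq1 : q < 1) {i j : ℕ} (hi : i ≠ 0)
    (hj : j ≠ 0) :
    HasDerivAt (fun x => fivePoch i x * fivePoch j x)
      (-(fivePoch i q * fivePoch j q * (fiveWeighted i q + fiveWeighted j q)) / q) q :=
  ((hasDerivAt_fivePoch hq0 hq1 hi).mul (hasDerivAt_fivePoch hq0 hq1 hj)).congr_deriv (by ring)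

/-- The ratio of `k⁻¹ - 11 - k`, where `k` is the fifth power of the Rogers–Ramanujan continued
fraction, to `uF`, with its singularity at the origin removed. -/
noncomputable def rogersRatio (q : ℝ) : ℝ :=
  (((fivePoch 2 q * fivePoch 3 q) / (fivePoch 1 q * fivePoch 4 q)) ^ 5 - 11 * q -
    q ^ 2 * ((fivePoch 1 q * fivePoch 4 q) / (fivePoch 2 q * fivePoch 3 q)) ^ 5) /
    ((fivePoch 1 q * fivePoch 4 q) * (fivePoch 2 q * fivePoch 3 q)) ^ 6

lemma hasDerivAt_rogersRatio {q : ℝ} (hq0 : 0 < q) (hq1 : q < 1) :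
    HasDerivAt rogersRatio 0 q := by
  have h1 := fivePoch_pos hq0 hq1 (i := 1) (by norm_num)
  have h2 := fivePoch_pos hq0 hq1 (i := 2) (by norm_num)
  have h3 := fivePoch_pos hq0 hq1 (i := 3) (by norm_num)
  have h4 := fivePoch_pos hq0 hq1 (i := 4) (by norm_num)
  have h5 := fivePoch_pos hq0 hq1 (i := 5) (by norm_num)
  have hE := fivePoch_sq_add_sq hq0 hq1
  have hA := fivePoch_sq_sub_sq hq0 hq1
  have da := hasDerivAt_fivePoch_mul hq0 hq1 one_ne_zero four_ne_zero
  have db := hasDerivAt_fivePoch_mul hq0 hq1 two_ne_zero three_ne_zero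
  have ha : 0 < fivePoch 1 q * fivePoch 4 q := by positivity
  have hb : 0 < fivePoch 2 q * fivePoch 3 q := by positivity
  have hd := ((((db.div da ha.ne').pow 5).sub ((hasDerivAt_id q).const_mul 11)).sub
    (((hasDerivAt_id q).pow 2).mul ((da.div db hb.ne').pow 5))).div ((da.mul db).pow 6)
    (by simp only [Pi.pow_apply, Pi.mul_apply]; positivity)
  refine hd.congr_deriv ?_
  simp only [Pi.pow_apply, Pi.mul_apply, Pi.sub_apply, Pi.div_apply, id]
  rw [show fiveWeighted 1 q - fiveWeighted 2 q - fiveWeighted 3 q + fiveWeighted 4 q =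
    (fiveWeighted 1 q + fiveWeighted 4 q) - (fiveWeighted 2 q + fiveWeighted 3 q) by ring] at hA
  rw [show fiveWeighted 1 q + fiveWeighted 2 q + fiveWeighted 3 q + fiveWeighted 4 q =
    (fiveWeighted 1 q + fiveWeighted 4 q) + (fiveWeighted 2 q + fiveWeighted 3 q) by ring] at hE
  clear hd da db h1 h2 h3 h4
  generalize fivePoch 1 q * fivePoch 4 q = a at *
  generalize fivePoch 2 q * fivePoch 3 q = b at *
  generalize fiveWeighted 1 q + fiveWeighted 4 q = S at *
  generalize fiveWeighted 2 q + fiveWeighted 3 q = R at *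
  generalize fivePoch 5 q = t at *
  have eS : ∀ y z : ℝ, y = 1 + 6 * (S + R) → z = 1 - 5 * (S - R) →
      S = (y - 1) / 12 + (1 - z) / 10 := by intros; linarith
  have eR : ∀ y z : ℝ, y = 1 + 6 * (S + R) → z = 1 - 5 * (S - R) →
      R = (y - 1) / 12 - (1 - z) / 10 := by intros; linarith
  rw [eS _ _ hE hA, eR _ _ hE hA]
  push_cast
  norm_num only
  field_simp
  ring

end

section

variable {q : ℝ} (hq0 : 0 < q) (hq1 : q < 1)

include hq0 hq1

theorem rogersRatio_eq_one : rogersRatio q = 1 := by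
  have h0 : rogersRatio 0 = 1 := by simp [rogersRatio, fivePoch_zero]
  have hc : ∀ {i : ℕ}, i ≠ 0 → ContinuousAt (fivePoch i) 0 := fun hi =>
    (hasDerivAt_fivePoch_of_abs_lt (by simp) hi).continuousAt
  have hcont0 : ContinuousAt rogersRatio 0 := by
    have ha := (hc one_ne_zero).mul (hc four_ne_zero)
    have hb := (hc two_ne_zero).mul (hc three_ne_zero)
    refine ((((hb.div ha ?_).pow 5).sub (continuousAt_id.const_mul 11)).sub
      ((continuousAt_id.pow 2).mul ((ha.div hb ?_).pow 5))).div ((ha.mul hb).pow 6) ?_ <;>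
    simp [fivePoch_zero]
  have hd : ∀ x ∈ Set.Ioo 0 q, HasDerivAt rogersRatio 0 x := fun x hx =>
    hasDerivAt_rogersRatio hx.1 (hx.2.trans hq1)
  have hcont : ContinuousOn rogersRatio (Set.Icc 0 q) := fun x hx => by
    rcases hx.1.eq_or_lt with rfl | h
    · exact hcont0.continuousWithinAt
    · exact (hasDerivAt_rogersRatio h (hx.2.trans_lt hq1)).continuousAt.continuousWithinAt
  obtain ⟨c, -, h⟩ := exists_hasDerivAt_eq_slope rogersRatio 0 hq0 hcont hd
  rw [eq_comm, Pi.zero_apply, div_eq_zero_iff, h0, sub_zero, or_iff_left hq0.ne'] at h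
  linarith

lemma eulerF_pos_s1 : 0 < eulerF q := by
  rw [eulerF_eq_prod_fivePoch (by rwa [abs_of_pos hq0])]
  have h := fun {i : ℕ} => fivePoch_pos hq0 hq1 (i := i)
  exact mul_pos (mul_pos (mul_pos (mul_pos (h one_ne_zero) (h two_ne_zero)) (h three_ne_zero))
    (h four_ne_zero)) (h (by norm_num))

lemma uF_pos_s1 : 0 < uF q := by
  have h1 := eulerF_pos_s1 hq0 hq1
  have h5 : 0 < eulerF (q ^ 5) := eulerF_pos_s1 (by positivity) (pow_lt_one₀ hq0.le hq1 (by norm_num))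
  unfold uF
  positivity

/-- The Eisenstein series of weight two and level five as a square root. -/
lemma mul_sqrt_uF_eq :
    q * (Real.sqrt (125 + 22 * uF q + uF q ^ 2) * (eulerF (q ^ 5) ^ 5 / eulerF q)) =
      1 + 6 * (fiveWeighted 1 q + fiveWeighted 2 q + fiveWeighted 3 q + fiveWeighted 4 q) := by
  have h1 := fivePoch_pos hq0 hq1 (i := 1) (by norm_num)
  have h2 := fivePoch_pos hq0 hq1 (i := 2) (by norm_num)
  have h3 := fivePoch_pos hq0 hq1 (i := 3) (by norm_num)
  have h4 := fivePoch_pos hq0 hq1 (i := 4) (by norm_num)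
  have h5 := fivePoch_pos hq0 hq1 (i := 5) (by norm_num)
  have h := rogersRatio_eq_one hq0 hq1
  rw [← fivePoch_sq_add_sq hq0 hq1, uF_eq_div hq0 hq1, eulerF_pow_five,
    eulerF_eq_prod_fivePoch (by rwa [abs_of_pos hq0]),
    show fivePoch 1 q * fivePoch 2 q * fivePoch 3 q * fivePoch 4 q * fivePoch 5 q =
      (fivePoch 1 q * fivePoch 4 q) * (fivePoch 2 q * fivePoch 3 q) * fivePoch 5 q by ring]
  have ha : 0 < fivePoch 1 q * fivePoch 4 q := by positivity
  have hb : 0 < fivePoch 2 q * fivePoch 3 q := by positivity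
  rw [rogersRatio, div_eq_one_iff_eq (by positivity)] at h
  generalize fivePoch 1 q * fivePoch 4 q = a at *
  generalize fivePoch 2 q * fivePoch 3 q = b at *
  generalize fivePoch 5 q = t at *
  have hs : 125 + 22 * ((a * b) ^ 6 / q) + ((a * b) ^ 6 / q) ^ 2 =
      (((b / a) ^ 5 + q ^ 2 * (a / b) ^ 5) / q) ^ 2 := by
    rw [← h]
    field_simp
    ring
  rw [hs, Real.sqrt_sq (by positivity)]
  field_simp

theorem hasDerivAt_uF :
    HasDerivAt uF
      (-(uF q * Real.sqrt (125 + 22 * uF q + uF q ^ 2) * (eulerF (q ^ 5) ^ 5 / eulerF q))) q := by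
  have da := hasDerivAt_fivePoch_mul hq0 hq1 one_ne_zero four_ne_zero
  have db := hasDerivAt_fivePoch_mul hq0 hq1 two_ne_zero three_ne_zero
  have hd := ((da.mul db).pow 6).div (hasDerivAt_id q) hq0.ne'
  refine (hd.congr_of_eventuallyEq ?_).congr_deriv ?_
  · filter_upwards [Ioo_mem_nhds hq0 hq1] with x hx using uF_eq_div hx.1 hx.2
  · refine mul_left_cancel₀ hq0.ne' ?_
    rw [mul_assoc (uF q), mul_neg, mul_left_comm q (uF q), mul_sqrt_uF_eq hq0 hq1, uF_eq_div hq0 hq1]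
    simp only [Pi.pow_apply, Pi.mul_apply, id]
    push_cast
    field_simp
    ring

end

end

theorem integral_G_u (G : ℝ → ℝ) (hG : ContinuousOn G (Set.Ioi 0))
    (a b : ℝ) (ha : 0 < a) (hab : a ≤ b) (hb : b < 1) :
    ∫ q in a..b, G (eulerF q ^ 6 / (q * eulerF (q ^ 5) ^ 6)) *
        eulerF (q ^ 5) ^ 5 / eulerF q =
      -∫ x in uF a..uF b, G x / (x * Real.sqrt (125 + 22 * x + x ^ 2)) := by
  have hI : ∀ x ∈ Set.uIcc a b, 0 < x ∧ x < 1 := fun x hx => by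
    rw [Set.uIcc_of_le hab] at hx
    exact ⟨ha.trans_le hx.1, hx.2.trans_lt hb⟩
  have hs : ∀ x : ℝ, 0 < x → 0 < x * Real.sqrt (125 + 22 * x + x ^ 2) := fun x hx => by positivity
  have hu : ContinuousOn uF (Set.uIcc a b) := fun x hx =>
    (hasDerivAt_uF (hI x hx).1 (hI x hx).2).continuousAt.continuousWithinAt
  have hf5 : ContinuousOn (fun q => eulerF (q ^ 5)) (Set.uIcc a b) := fun x hx => by
    simp only [eulerF_pow_five]
    exact (hasDerivAt_fivePoch (hI x hx).1 (hI x hx).2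
      (by norm_num)).continuousAt.continuousWithinAt
  have hf1 : ContinuousOn eulerF (Set.uIcc a b) := by
    have hc : ∀ {i : ℕ}, i ≠ 0 → ContinuousOn (fivePoch i) (Set.uIcc a b) := fun hi x hx =>
      (hasDerivAt_fivePoch (hI x hx).1 (hI x hx).2 hi).continuousAt.continuousWithinAt
    refine ((((hc one_ne_zero).mul (hc two_ne_zero)).mul (hc three_ne_zero)).mul
      (hc four_ne_zero)).mul (hc (by norm_num : 5 ≠ 0)) |>.congr fun x hx => ?_
    exact eulerF_eq_prod_fivePoch (abs_lt.2 ⟨by linarith [(hI x hx).1], (hI x hx).2⟩)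
  have hg : ContinuousOn (fun x => G x / (x * Real.sqrt (125 + 22 * x + x ^ 2))) (Set.Ioi 0) :=
    hG.div (by fun_prop) fun x hx => (hs x hx).ne'
  have key := intervalIntegral.integral_comp_mul_deriv'
    (fun x hx => hasDerivAt_uF (hI x hx).1 (hI x hx).2)
    ((hu.mul (by fun_prop)).mul
      ((hf5.pow 5).div hf1 fun x hx => (eulerF_pos_s1 (hI x hx).1 (hI x hx).2).ne')).neg
    (hg.mono (Set.image_subset_iff.2 fun x hx => uF_pos_s1 (hI x hx).1 (hI x hx).2))
  rw [← key, ← intervalIntegral.integral_neg]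
  refine intervalIntegral.integral_congr fun x hx => ?_
  have h := hs _ (uF_pos_s1 (hI x hx).1 (hI x hx).2)
  simp only [Function.comp_apply]
  rw [← uF, mul_neg, neg_neg, ← mul_assoc, div_mul_cancel₀ _ h.ne', mul_div_assoc]
end
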